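/- Under the reverse (f,Γ)-GAN assumptions (see context), for every ε > 0: ℙ( D_f^Γ(P_{θ*_{n,m}}‖Q) − inf_{θ∈Θ} D_f^Γ(P_θ‖Q) ≥ ε + ε_{approx}^{Γ,Γ̃} + ε^{opt}_{n,m} + 4 R_{Γ̃∘Φ,P_Z,m} + 4 K_{f,Γ̃,Q,n} ) ≤ exp( −ε² / ( (2/m)(β−α)² + (2/n) Δ_{f,n}² ) ). -/

import Mathlib

open MeasureTheory Set Filter Topology
open scoped ENNReal NNReal Classical

noncomputable section

/-- The interval `(a, b)` with `b` possibly infinite. -/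
def Dom (a : ℝ) (b : EReal) : Set ℝ := {t : ℝ | a < t ∧ (t : EReal) < b}

/-- Legendre transform of `f` on `(a,b)`, with values in `(-∞, ∞]` (modeled by `EReal`). -/
def fStar (f : ℝ → ℝ) (a : ℝ) (b : EReal) (z : ℝ) : EReal :=
  ⨆ t ∈ Dom a b, ((z * t - f t : ℝ) : EReal)

/-- Real-valued version of the Legendre transform (junk value where it is `⊤`). -/
def fStarR (f : ℝ → ℝ) (a : ℝ) (b : EReal) (z : ℝ) : ℝ := (fStar f a b z).toReal

/-- Right derivative of `g` at `z`. -/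
def rderiv (g : ℝ → ℝ) (z : ℝ) : ℝ := derivWithin g (Ici z) z

/-- `z₀ := f'_+(1)`. -/
def zz (f : ℝ → ℝ) : ℝ := rderiv f 1

/-- Integral of an `EReal`-valued function: the Bochner integral if the function is
a.e. finite and integrable, and `⊤` otherwise. -/
def eIntegral {X : Type*} [MeasurableSpace X] (P : Measure X) (g : X → EReal) : EReal :=
  if (∀ᵐ x ∂P, g x ≠ ⊤) ∧ Integrable (fun x => (g x).toReal) P
  then ((∫ x, (g x).toReal ∂P : ℝ) : EReal) else ⊤

/-- The generalized cumulant generating function `Λ_f^P[h]`. -/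
def cgf {X : Type*} [MeasurableSpace X] (f : ℝ → ℝ) (a : ℝ) (b : EReal)
    (P : Measure X) (h : X → ℝ) : EReal :=
  ⨅ ν : ℝ, ((ν : EReal) + eIntegral P (fun x => fStar f a b (h x - ν)))

/-- Real-valued `Λ_f^P[h]`. -/
def cgfR {X : Type*} [MeasurableSpace X] (f : ℝ → ℝ) (a : ℝ) (b : EReal)
    (P : Measure X) (h : X → ℝ) : ℝ := (cgf f a b P h).toReal

/-- `Λ_f : ℝⁿ → ℝ` (with values in `EReal`). -/
def lamVec (f : ℝ → ℝ) (a : ℝ) (b : EReal) {n : ℕ} (x : Fin n → ℝ) : EReal :=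
  ⨅ ν : ℝ, ((ν : EReal) + ((n : ℝ)⁻¹ : EReal) * ∑ i, fStar f a b (x i - ν))

/-- Empirical measure of `n` points. -/
def empMeas {X : Type*} [MeasurableSpace X] (n : ℕ) (xs : Fin n → X) : Measure X :=
  (n : ℝ≥0∞)⁻¹ • ∑ i, Measure.dirac (xs i)

/-- The `(f,Γ)`-divergence `D_f^Γ(Q‖P)`. -/
def Dfg {X : Type*} [MeasurableSpace X] (f : ℝ → ℝ) (a : ℝ) (b : EReal)
    (Γ : Set (X → ℝ)) (Q P : Measure X) : ℝ :=
  sSup {r : ℝ | ∃ h ∈ Γ, r = ∫ x, h x ∂Q - cgfR f a b P h}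

/-- Empirical Rademacher complexity of `Ψ` at the sample `y`. -/
def empRad {Y : Type*} (Ψ : Set (Y → ℝ)) (n : ℕ) (y : Fin n → Y) : ℝ :=
  (2 ^ n : ℝ)⁻¹ * ∑ σ : Fin n → Bool,
    sSup {r : ℝ | ∃ ψ ∈ Ψ, r = (n : ℝ)⁻¹ * ∑ i, (if σ i then 1 else -1) * ψ (y i)}

/-- Rademacher complexity of `Ψ` relative to `P` with `n` samples. -/
def rad {Y : Type*} [MeasurableSpace Y] (Ψ : Set (Y → ℝ)) (P : Measure Y) (n : ℕ) : ℝ :=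
  ∫ y, empRad Ψ n y ∂(Measure.pi fun _ : Fin n => P)

/-- `Δ_{f,n}`. -/
def Δq (f : ℝ → ℝ) (a : ℝ) (b : EReal) (α β : ℝ) (n : ℕ) : ℝ :=
  sInf ((fun z => (n : ℝ) * (-z + (((n : ℝ) - 1) / (n : ℝ)) * fStarR f a b z
      + (1 / (n : ℝ)) * fStarR f a b (β - α + z))) '' Icc (zz f - (β - α)) (zz f))

/-- `sup_{h ∈ Γ} inf_{h̃ ∈ Γ̃} ‖h − h̃‖_∞`. -/
def approxErr {X : Type*} (Γ Γt : Set (X → ℝ)) : ℝ :=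
  sSup {r : ℝ | ∃ h ∈ Γ, r = sInf {s : ℝ | ∃ ht ∈ Γt, s = ⨆ x, |h x - ht x|}}

/-- A countable subset which is pointwise-limit dense. -/
def PtwiseDenseCount {X : Type*} (Γ : Set (X → ℝ)) : Prop :=
  ∃ Γ₀ ⊆ Γ, Γ₀.Countable ∧ ∀ h ∈ Γ, ∃ s : ℕ → X → ℝ,
    (∀ j, s j ∈ Γ₀) ∧ ∀ x, Tendsto (fun j => s j x) atTop (𝓝 (h x))

/-- The quantity `K_{f,Ψ,P,n}` from Definition 3.4: either `(f*)'_+` is Lipschitz on the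
relevant interval and `Ψ` contains a constant, in which case `K` is the minimum of the two
expressions, or `K` is the second expression. -/
def Kchoice (f : ℝ → ℝ) (a : ℝ) (b : EReal) (α β : ℝ) {Y : Type*} [MeasurableSpace Y]
    (Ψ : Set (Y → ℝ)) (P : Measure Y) (n : ℕ) (K : ℝ) : Prop :=
  (∃ L : ℝ≥0, LipschitzOnWith L (rderiv (fStarR f a b))
      (Icc (zz f - (β - α)) (zz f + (β - α))) ∧
    (∃ c : ℝ, (fun _ => c) ∈ Ψ) ∧
    K = min ((1 + 2 * (β - α) * (L : ℝ)) * rad Ψ P n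
        + (β - α) ^ 2 * (L : ℝ) / (2 * Real.sqrt n))
      (rderiv (fStarR f a b) (β - α + zz f) * (rad Ψ P n + (β - α) / (2 * Real.sqrt n))))
  ∨ K = rderiv (fStarR f a b) (β - α + zz f) * (rad Ψ P n + (β - α) / (2 * Real.sqrt n))

/-- Covering number of a (pseudo)metric space by `ε`-balls. -/
def coverNum (Θ : Type*) [PseudoMetricSpace Θ] (ε : ℝ) : ℝ≥0∞ :=
  ⨅ s ∈ {s : Finset Θ | ∀ θ : Θ, ∃ c ∈ s, dist θ c ≤ ε}, ((s.card : ℝ≥0∞))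

end

/-- The sign in `{-1, 1}` encoded by a Boolean. -/
noncomputable def boolSign (s : Bool) : ℝ := if s then 1 else -1

theorem abs_boolSign (s : Bool) : |boolSign s| = 1 := by cases s <;> simp [boolSign]

theorem boolSign_not (s : Bool) : boolSign (!s) = -boolSign s := by cases s <;> simp [boolSign]

theorem sum_bool_succ {n : ℕ} (G : (Fin (n + 1) → Bool) → ℝ) :
    ∑ σ, G σ = ∑ σ : Fin n → Bool, (G (Fin.cons true σ) + G (Fin.cons false σ)) := by
  rw [← (Fin.consEquiv fun _ : Fin (n + 1) => Bool).sum_comp, Fintype.sum_prod_type,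
    Finset.sum_comm]
  simp [Fin.consEquiv]

theorem bddAbove_of_abs_le {ι : Sort*} {a : ι → ℝ} {C : ℝ} (h : ∀ i, |a i| ≤ C) :
    BddAbove (range a) :=
  ⟨C, by rintro _ ⟨i, rfl⟩; exact (abs_le.1 (h i)).2⟩

theorem abs_ciSup_le {ι : Sort*} [Nonempty ι] {a : ι → ℝ} {C : ℝ} (h : ∀ i, |a i| ≤ C) :
    |⨆ i, a i| ≤ C :=
  abs_le.2 ⟨(abs_le.1 (h (Classical.arbitrary ι))).1.trans
    (le_ciSup (bddAbove_of_abs_le h) _), ciSup_le fun i => (abs_le.1 (h i)).2⟩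

theorem abs_ciSup_sub_ciSup_le {ι : Sort*} [Nonempty ι] {a b : ι → ℝ} {c : ℝ}
    (ha : BddAbove (range a)) (hb : BddAbove (range b)) (h : ∀ i, |a i - b i| ≤ c) :
    |(⨆ i, a i) - ⨆ i, b i| ≤ c := by
  have h1 : (⨆ i, a i) ≤ (⨆ i, b i) + c := ciSup_le fun i => by
    have := le_ciSup hb i
    have := abs_le.1 (h i)
    linarith
  have h2 : (⨆ i, b i) ≤ (⨆ i, a i) + c := ciSup_le fun i => by
    have := le_ciSup ha i
    have := abs_le.1 (h i)
    linarith
  exact abs_le.2 ⟨by linarith, by linarith⟩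

/-- One coordinate of the contraction principle. -/
theorem ciSup_add_ciSup_sub_le {ι : Type*} [Nonempty ι] {a u v : ι → ℝ} {C : ℝ}
    (ha : ∀ i, |a i| ≤ C) (hu : ∀ i, |u i| ≤ C) (huv : ∀ i j, |v i - v j| ≤ |u i - u j|) :
    (⨆ i, (a i + v i)) + (⨆ i, (a i - v i)) ≤ (⨆ i, (a i + u i)) + ⨆ i, (a i - u i) := by
  have b1 : BddAbove (range fun i => a i + u i) := bddAbove_of_abs_le (C := C + C) fun i =>
    (abs_add_le _ _).trans (add_le_add (ha i) (hu i))
  have b2 : BddAbove (range fun i => a i - u i) := bddAbove_of_abs_le (C := C + C) fun i =>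
    (abs_sub _ _).trans (add_le_add (ha i) (hu i))
  rw [← le_sub_iff_add_le]
  refine ciSup_le fun i => ?_
  rw [le_sub_comm]
  refine ciSup_le fun j => ?_
  have h1 := le_ciSup b1 i
  have h2 := le_ciSup b2 j
  have h3 := le_ciSup b1 j
  have h4 := le_ciSup b2 i
  have h := (le_abs_self _).trans (huv i j)
  rcases abs_cases (u i - u j) with ⟨e, _⟩ | ⟨e, _⟩ <;> rw [e] at h <;> linarith

theorem abs_sum_boolSign_mul_le {n : ℕ} (σ : Fin n → Bool) {v : Fin n → ℝ} {C : ℝ}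
    (hv : ∀ k, |v k| ≤ C) : |∑ k, boolSign (σ k) * v k| ≤ n * C := by
  refine (Finset.abs_sum_le_sum_abs _ _).trans ?_
  refine (Finset.sum_le_sum (g := fun _ => C) fun k _ => ?_).trans_eq (by simp)
  rw [abs_mul, abs_boolSign, one_mul]; exact hv k

theorem sum_ciSup_boolSign_contraction_aux {ι : Type*} [Nonempty ι] (n : ℕ) (a : ι → ℝ)
    (u v : ι → Fin n → ℝ) {C : ℝ} (ha : ∃ A, ∀ i, |a i| ≤ A) (hu : ∀ i k, |u i k| ≤ C)
    (hv : ∀ i k, |v i k| ≤ C) (huv : ∀ k i j, |v i k - v j k| ≤ |u i k - u j k|) :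
    ∑ σ : Fin n → Bool, ⨆ i, (a i + ∑ k, boolSign (σ k) * v i k) ≤
      ∑ σ : Fin n → Bool, ⨆ i, (a i + ∑ k, boolSign (σ k) * u i k) := by
  induction n generalizing a with
  | zero => simp
  | succ n ih =>
    obtain ⟨A, hA⟩ := ha
    rw [sum_bool_succ, sum_bool_succ]
    simp only [Fin.sum_univ_succ, Fin.cons_zero, Fin.cons_succ]
    have h1 : ∀ σ : Fin n → Bool,
        (⨆ i, (a i + (boolSign true * v i 0 + ∑ k, boolSign (σ k) * v i k.succ))) +
          (⨆ i, (a i + (boolSign false * v i 0 + ∑ k, boolSign (σ k) * v i k.succ))) ≤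
        (⨆ i, (a i + boolSign true * u i 0 + ∑ k, boolSign (σ k) * v i k.succ)) +
          (⨆ i, (a i + boolSign false * u i 0 + ∑ k, boolSign (σ k) * v i k.succ)) := by
      intro σ
      have := ciSup_add_ciSup_sub_le (a := fun i => a i + ∑ k, boolSign (σ k) * v i k.succ)
        (u := fun i => u i 0) (v := fun i => v i 0) (C := max (A + n * C) C)
        (fun i => ((abs_add_le _ _).trans (add_le_add (hA i)
          (abs_sum_boolSign_mul_le σ fun k => hv i k.succ))).trans (le_max_left _ _))
        (fun i => (hu i 0).trans (le_max_right _ _)) (huv 0)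
      have e : ∀ s w : ℝ, ∀ i, a i + (s * w + ∑ k, boolSign (σ k) * v i k.succ) =
          a i + ∑ k, boolSign (σ k) * v i k.succ + s * w := fun s w i => by ring
      have e' : ∀ s w : ℝ, ∀ i, a i + s * w + ∑ k, boolSign (σ k) * v i k.succ =
          a i + ∑ k, boolSign (σ k) * v i k.succ + s * w := fun s w i => by ring
      simp only [e, e']
      simpa [boolSign, sub_eq_add_neg] using this
    refine (Finset.sum_le_sum fun σ _ => h1 σ).trans ?_
    rw [Finset.sum_add_distrib]
    have h2 : ∀ s, ∑ σ : Fin n → Bool,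
        (⨆ i, (a i + boolSign s * u i 0 + ∑ k, boolSign (σ k) * v i k.succ)) ≤
        ∑ σ : Fin n → Bool,
        (⨆ i, (a i + (boolSign s * u i 0 + ∑ k, boolSign (σ k) * u i k.succ))) := by
      intro s
      simp only [← add_assoc]
      refine ih (fun i => a i + boolSign s * u i 0) (fun i k => u i k.succ)
        (fun i k => v i k.succ) ⟨A + C, fun i => (abs_add_le _ _).trans (add_le_add (hA i) ?_)⟩
        (fun i k => hu i k.succ) (fun i k => hv i k.succ) fun k => huv k.succ
      rw [abs_mul, abs_boolSign, one_mul]; exact hu i 0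
    refine (add_le_add (h2 true) (h2 false)).trans_eq ?_
    rw [Finset.sum_add_distrib]

/-- The Rademacher average of a family of vectors. -/
noncomputable def radAvg {ι : Type*} {n : ℕ} (v : ι → Fin n → ℝ) : ℝ :=
  (2 ^ n : ℝ)⁻¹ * ∑ σ : Fin n → Bool, ⨆ i, (n : ℝ)⁻¹ * ∑ k, boolSign (σ k) * v i k

theorem abs_avg_boolSign_le {n : ℕ} (σ : Fin n → Bool) {v : Fin n → ℝ} {C : ℝ} (hC : 0 ≤ C)
    (hv : ∀ k, |v k| ≤ C) : |(n : ℝ)⁻¹ * ∑ k, boolSign (σ k) * v k| ≤ C := by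
  rw [abs_mul, abs_of_nonneg (by positivity)]
  rcases Nat.eq_zero_or_pos n with rfl | hn
  · simpa using hC
  · have : (0 : ℝ) < n := by exact_mod_cast hn
    rw [inv_mul_le_iff₀ this]
    exact abs_sum_boolSign_mul_le σ hv

/-- Contraction principle (Ledoux–Talagrand). -/
theorem radAvg_contraction {ι : Type*} [Nonempty ι] {n : ℕ} {u v : ι → Fin n → ℝ} {C L : ℝ}
    (hL : 0 ≤ L) (hu : ∀ i k, |u i k| ≤ C) (hv : ∀ i k, |v i k| ≤ C)
    (huv : ∀ k i j, |v i k - v j k| ≤ L * |u i k - u j k|) :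
    radAvg v ≤ L * radAvg u := by
  have h := sum_ciSup_boolSign_contraction_aux n (fun _ => 0) (fun i k => L * u i k) v
    (C := max C (L * C)) ⟨0, by simp⟩
    (fun i k => by
      rw [abs_mul, abs_of_nonneg hL]
      exact (mul_le_mul_of_nonneg_left (hu i k) hL).trans (le_max_right _ _))
    (fun i k => (hv i k).trans (le_max_left _ _))
    (fun k i j => by rw [← mul_sub, abs_mul, abs_of_nonneg hL]; exact huv k i j)
  simp only [zero_add, mul_left_comm _ L, ← Finset.mul_sum] at h
  simp only [← Real.mul_iSup_of_nonneg hL, ← Finset.mul_sum] at h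
  simp only [radAvg, ← Real.mul_iSup_of_nonneg (by positivity : (0 : ℝ) ≤ (n : ℝ)⁻¹),
    ← Finset.mul_sum]
  calc _ ≤ (2 ^ n : ℝ)⁻¹ * ((n : ℝ)⁻¹ * (L * _)) := by gcongr
    _ = _ := by ring

theorem sum_boolSign {n : ℕ} (k : Fin n) : ∑ σ : Fin n → Bool, boolSign (σ k) = 0 := by
  have h : ∑ σ : Fin n → Bool, boolSign (σ k) = ∑ σ : Fin n → Bool, -boolSign (σ k) := by
    rw [← (Equiv.piCongrRight fun _ : Fin n => Equiv.boolNot).sum_comp]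
    simp [boolSign_not]
  rw [Finset.sum_neg_distrib] at h
  linarith

theorem sum_boolSign_mul {n : ℕ} (v : Fin n → ℝ) :
    ∑ σ : Fin n → Bool, ∑ k, boolSign (σ k) * v k = 0 := by
  rw [Finset.sum_comm]
  simp [← Finset.sum_mul, sum_boolSign]

theorem radAvg_nonneg {ι : Type*} [Nonempty ι] {n : ℕ} {v : ι → Fin n → ℝ} {C : ℝ}
    (hC : 0 ≤ C) (hv : ∀ i k, |v i k| ≤ C) : 0 ≤ radAvg v := by
  have i₀ := Classical.arbitrary ι
  have h : ∑ σ : Fin n → Bool, (n : ℝ)⁻¹ * ∑ k, boolSign (σ k) * v i₀ k = 0 := by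
    rw [← Finset.mul_sum, sum_boolSign_mul, mul_zero]
  rw [radAvg]
  refine mul_nonneg (by positivity) ?_
  rw [← h]
  exact Finset.sum_le_sum fun σ _ =>
    le_ciSup (f := fun i => (n : ℝ)⁻¹ * ∑ k, boolSign (σ k) * v i k)
      (bddAbove_of_abs_le fun i => abs_avg_boolSign_le σ hC (hv i)) i₀

theorem abs_radAvg_le {ι : Type*} [Nonempty ι] {n : ℕ} {v : ι → Fin n → ℝ} {C : ℝ}
    (hC : 0 ≤ C) (hv : ∀ i k, |v i k| ≤ C) : |radAvg v| ≤ C := by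
  rw [radAvg, abs_mul, abs_of_nonneg (by positivity), inv_mul_le_iff₀ (by positivity)]
  refine (Finset.abs_sum_le_sum_abs _ _).trans ?_
  refine (Finset.sum_le_sum (g := fun _ => C) fun σ _ =>
    abs_ciSup_le fun i => abs_avg_boolSign_le σ hC (hv i)).trans_eq ?_
  simp

theorem radAvg_neg {ι : Type*} {n : ℕ} (v : ι → Fin n → ℝ) :
    radAvg (fun i k => -v i k) = radAvg v := by
  rw [radAvg, radAvg, ← (Equiv.piCongrRight fun _ : Fin n => Equiv.boolNot).sum_comp]
  simp [boolSign_not]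

theorem sum_sq_sum_boolSign (n : ℕ) :
    ∑ σ : Fin n → Bool, (∑ k, boolSign (σ k)) ^ 2 = n * 2 ^ n := by
  induction n with
  | zero => simp
  | succ n ih =>
    rw [sum_bool_succ]
    simp only [Fin.sum_univ_succ, Fin.cons_zero, Fin.cons_succ]
    have : ∀ σ : Fin n → Bool, (boolSign true + ∑ k, boolSign (σ k)) ^ 2 +
        (boolSign false + ∑ k, boolSign (σ k)) ^ 2 = 2 + 2 * (∑ k, boolSign (σ k)) ^ 2 := by
      intro σ
      simp only [boolSign, if_true, Bool.false_eq_true, if_false]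
      ring
    simp only [this, Finset.sum_add_distrib, ← Finset.mul_sum, ih]
    simp
    ring

theorem sum_abs_sum_boolSign_le (n : ℕ) :
    ∑ σ : Fin n → Bool, |∑ k, boolSign (σ k)| ≤ 2 ^ n * √n := by
  refine abs_le_of_sq_le_sq' ?_ (by positivity) |>.2
  have h := sq_sum_le_card_mul_sum_sq (s := (Finset.univ : Finset (Fin n → Bool)))
    (f := fun σ => |∑ k, boolSign (σ k)|)
  refine h.trans_eq ?_
  simp only [sq_abs, sum_sq_sum_boolSign, mul_pow, Real.sq_sqrt (Nat.cast_nonneg n)]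
  simp
  ring

/-- Rademacher average of a family enlarged by translations with parameters from an interval. -/
theorem radAvg_sub_le {ι κ : Type*} [Nonempty ι] [Nonempty κ] {n : ℕ} (hn : 0 < n)
    {u : ι → Fin n → ℝ} {ν : κ → ℝ} {C p w : ℝ} (hC : 0 ≤ C) (hu : ∀ i k, |u i k| ≤ C)
    (hν : ∀ j, |ν j - p| ≤ w / 2) :
    radAvg (fun (q : ι × κ) k => u q.1 k - ν q.2) ≤ radAvg u + w / (2 * √n) := by
  have hn' : (0 : ℝ) < n := by exact_mod_cast hn
  have hw : 0 ≤ w / 2 := (abs_nonneg _).trans (hν (Classical.arbitrary κ))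
  have key : ∀ σ : Fin n → Bool,
      (⨆ q : ι × κ, (n : ℝ)⁻¹ * ∑ k, boolSign (σ k) * (u q.1 k - ν q.2)) ≤
      (⨆ i, (n : ℝ)⁻¹ * ∑ k, boolSign (σ k) * u i k) +
        (n : ℝ)⁻¹ * (w / 2 * |∑ k, boolSign (σ k)| - (∑ k, boolSign (σ k)) * p) := by
    intro σ
    refine ciSup_le fun q => ?_
    have h1 := le_ciSup (f := fun i => (n : ℝ)⁻¹ * ∑ k, boolSign (σ k) * u i k)
      (bddAbove_of_abs_le fun i => abs_avg_boolSign_le σ hC (hu i)) q.1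
    have h2 : -((∑ k, boolSign (σ k)) * (ν q.2 - p)) ≤ w / 2 * |∑ k, boolSign (σ k)| := by
      refine (neg_le_abs _).trans ?_
      rw [abs_mul, mul_comm]
      gcongr
      exact hν _
    have h3 : (n : ℝ)⁻¹ * -((∑ k, boolSign (σ k)) * (ν q.2 - p)) ≤
      (n : ℝ)⁻¹ * (w / 2 * |∑ k, boolSign (σ k)|) := by gcongr
    simp only [mul_sub, Finset.sum_sub_distrib, ← Finset.sum_mul] at *
    linarith
  have h1 := Finset.sum_le_sum fun σ (_ : σ ∈ Finset.univ) => key σ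
  rw [Finset.sum_add_distrib, ← Finset.mul_sum, Finset.sum_sub_distrib, ← Finset.mul_sum,
    ← Finset.sum_mul] at h1
  have h0 : ∑ σ : Fin n → Bool, ∑ k, boolSign (σ k) = 0 := by
    simpa using sum_boolSign_mul (fun _ : Fin n => (1 : ℝ))
  rw [h0, zero_mul, sub_zero] at h1
  have h2 : (n : ℝ)⁻¹ * (w / 2 * ∑ σ : Fin n → Bool, |∑ k, boolSign (σ k)|) ≤
      (n : ℝ)⁻¹ * (w / 2 * (2 ^ n * √n)) := by
    gcongr; exact sum_abs_sum_boolSign_le n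
  have h3 : (n : ℝ)⁻¹ * (w / 2 * (2 ^ n * √n)) = 2 ^ n * (w / (2 * √n)) := by
    have hs : √(n : ℝ) * √n = n := Real.mul_self_sqrt hn'.le
    have hs0 : 0 < √(n : ℝ) := Real.sqrt_pos.2 hn'
    field_simp
    rw [pow_two, hs, mul_comm]
  rw [radAvg, radAvg, inv_mul_le_iff₀ (by positivity), mul_add, ← mul_assoc,
    mul_inv_cancel₀ (by positivity), one_mul, ← h3]
  exact h1.trans (by linarith)

theorem abs_integral_le_of_abs_le {A : Type*} [MeasurableSpace A] {μ : Measure A}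
    [IsProbabilityMeasure μ] {g : A → ℝ} {C : ℝ} (h : ∀ x, |g x| ≤ C) : |∫ x, g x ∂μ| ≤ C := by
  simpa using norm_integral_le_of_norm_le_const (μ := μ) (f := g) (C := C)
    (ae_of_all _ fun x => (Real.norm_eq_abs _).trans_le (h x))

/-- Sub-Gaussian bounds tensorize: conditionally on the second coordinate, and then for the
partial average. -/
theorem hasSubgaussianMGF_prod {A B : Type*} [MeasurableSpace A] [MeasurableSpace B]
    (μ : Measure A) (ν : Measure B) [IsProbabilityMeasure μ] [IsProbabilityMeasure ν]
    {F : A × B → ℝ} (hF : Measurable F) {C : ℝ} (hC : ∀ p, |F p| ≤ C) {c₁ c₂ : ℝ≥0}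
    (h₁ : ∀ y, ProbabilityTheory.HasSubgaussianMGF
      (fun x => F (x, y) - ∫ x', F (x', y) ∂μ) c₁ μ)
    (h₂ : ProbabilityTheory.HasSubgaussianMGF
      (fun y => ∫ x, F (x, y) ∂μ - ∫ y', ∫ x, F (x, y') ∂μ ∂ν) c₂ ν) :
    ProbabilityTheory.HasSubgaussianMGF (fun p => F p - ∫ q, F q ∂(μ.prod ν)) (c₁ + c₂)
      (μ.prod ν) := by
  have hFi : Integrable F (μ.prod ν) :=
    Integrable.of_bound hF.aestronglyMeasurable C (ae_of_all _ hC)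
  have hE : ∫ q, F q ∂(μ.prod ν) = ∫ y', ∫ x, F (x, y') ∂μ ∂ν := integral_prod_symm F hFi
  have hint : ∀ t : ℝ, Integrable (fun p => Real.exp (t * (F p - ∫ q, F q ∂(μ.prod ν))))
      (μ.prod ν) := fun t =>
    ProbabilityTheory.integrable_exp_mul_of_mem_Icc (a := -C - ∫ q, F q ∂(μ.prod ν))
      (b := C - ∫ q, F q ∂(μ.prod ν)) (hF.sub_const _).aemeasurable
      (ae_of_all _ fun p => by
        have := abs_le.1 (hC p)
        constructor <;> linarith)
  refine ⟨hint, fun t => ?_⟩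
  have key : ∀ y, ∫ x, Real.exp (t * (F (x, y) - ∫ q, F q ∂(μ.prod ν))) ∂μ ≤
      Real.exp (c₁ * t ^ 2 / 2) *
        Real.exp (t * (∫ x, F (x, y) ∂μ - ∫ y', ∫ x, F (x, y') ∂μ ∂ν)) := by
    intro y
    have h := (h₁ y).mgf_le t
    rw [ProbabilityTheory.mgf] at h
    calc ∫ x, Real.exp (t * (F (x, y) - ∫ q, F q ∂(μ.prod ν))) ∂μ
        = ∫ x, Real.exp (t * (F (x, y) - ∫ x', F (x', y) ∂μ)) *
          Real.exp (t * (∫ x, F (x, y) ∂μ - ∫ y', ∫ x, F (x, y') ∂μ ∂ν)) ∂μ := by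
          congr 1; ext x
          rw [← Real.exp_add, hE]; congr 1; ring
      _ ≤ _ := by
          rw [integral_mul_const]
          gcongr
  rw [ProbabilityTheory.mgf, integral_prod_symm _ (hint t)]
  calc ∫ y, ∫ x, Real.exp (t * (F (x, y) - ∫ q, F q ∂(μ.prod ν))) ∂μ ∂ν
      ≤ ∫ y, Real.exp (c₁ * t ^ 2 / 2) *
        Real.exp (t * (∫ x, F (x, y) ∂μ - ∫ y', ∫ x, F (x, y') ∂μ ∂ν)) ∂ν :=
        integral_mono (hint t).integral_prod_right ((h₂.integrable_exp_mul t).const_mul _) key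
    _ ≤ Real.exp (c₁ * t ^ 2 / 2) * Real.exp (c₂ * t ^ 2 / 2) := by
        rw [integral_const_mul]
        gcongr
        exact h₂.mgf_le t
    _ = _ := by
        rw [← Real.exp_add]; congr 1; push_cast; ring

/-- Hoeffding's lemma for a function whose oscillation is at most `c`. -/
theorem hasSubgaussianMGF_of_oscillation {A : Type*} [MeasurableSpace A] (μ : Measure A)
    [IsProbabilityMeasure μ] {F : A → ℝ} (hF : Measurable F) {c : ℝ≥0}
    (hc : ∀ x y, |F x - F y| ≤ c) :
    ProbabilityTheory.HasSubgaussianMGF (fun x => F x - ∫ y, F y ∂μ) ((c / 2) ^ 2) μ := by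
  obtain ⟨x₀⟩ : Nonempty A := nonempty_of_isProbabilityMeasure μ
  have hbdd : BddBelow (range F) := ⟨F x₀ - c, by
    rintro _ ⟨x, rfl⟩
    have := abs_le.1 (hc x x₀)
    linarith⟩
  have : Nonempty A := ⟨x₀⟩
  have h := ProbabilityTheory.hasSubgaussianMGF_of_mem_Icc (μ := μ) (a := ⨅ x, F x)
    (b := (⨅ x, F x) + c) hF.aemeasurable (ae_of_all _ fun x => by
      refine ⟨ciInf_le hbdd x, ?_⟩
      have : F x - c ≤ ⨅ y, F y := le_ciInf fun y => by
        have := abs_le.1 (hc x y)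
        linarith
      linarith)
  simpa using h

/-- McDiarmid's inequality in sub-Gaussian form for functions on a product space. -/
theorem hasSubgaussianMGF_pi {A : Type*} [MeasurableSpace A] (μ : Measure A)
    [IsProbabilityMeasure μ] {c : ℝ≥0} (n : ℕ) {F : (Fin n → A) → ℝ} (hF : Measurable F)
    {C : ℝ} (hC : ∀ x, |F x| ≤ C)
    (hc : ∀ x i u, |F (Function.update x i u) - F x| ≤ c) :
    ProbabilityTheory.HasSubgaussianMGF
      (fun x => F x - ∫ y, F y ∂(Measure.pi fun _ : Fin n => μ)) (n * (c / 2) ^ 2)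
      (Measure.pi fun _ : Fin n => μ) := by
  induction n with
  | zero =>
    have : (fun x : Fin 0 → A => F x - ∫ y, F y ∂(Measure.pi fun _ : Fin 0 => μ)) =
        fun _ => 0 := by
      ext x
      have : ∀ y, F y = F x := fun y => by rw [Subsingleton.elim y x]
      simp [this]
    rw [this]
    simp
  | succ n ih =>
    have e := measurePreserving_piFinSuccAbove (fun _ : Fin (n + 1) => μ) 0
    set φ := MeasurableEquiv.piFinSuccAbove (fun _ : Fin (n + 1) => A) 0 with hφ
    have hsymm : ∀ p, φ.symm p = Fin.cons p.1 p.2 := fun p => by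
      rw [hφ]; ext j; simp [MeasurableEquiv.piFinSuccAbove]
    have hGm : Measurable fun p => F (φ.symm p) := hF.comp φ.symm.measurable
    have hGi : ∀ y, Integrable (fun x => F (φ.symm (x, y))) μ := fun y =>
      Integrable.of_bound (hGm.comp measurable_prodMk_right).aestronglyMeasurable C
        (ae_of_all _ fun _ => hC _)
    have hprod := hasSubgaussianMGF_prod μ (Measure.pi fun _ : Fin n => μ)
      (F := fun p => F (φ.symm p)) hGm (fun p => hC _) (c₁ := (c / 2) ^ 2)
      (c₂ := n * (c / 2) ^ 2)
      (fun y => hasSubgaussianMGF_of_oscillation μ (hGm.comp measurable_prodMk_right) fun a a' => by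
        have := hc (φ.symm (a', y)) 0 a
        simp only [hsymm, Fin.update_cons_zero] at this
        simpa only [Function.comp_apply, hsymm] using this)
      (ih (F := fun y => ∫ x, F (φ.symm (x, y)) ∂μ)
        (hGm.stronglyMeasurable.integral_prod_left'.measurable)
        (fun y =>
           abs_integral_le_of_abs_le fun _ => hC _)
        (fun y i u => by
          rw [← integral_sub (hGi _) (hGi _)]
          refine abs_integral_le_of_abs_le fun x => ?_
          have := hc (φ.symm (x, y)) i.succ u
          simpa only [hsymm, Fin.cons_update] using this))
    have hint : ∫ y, F y ∂(Measure.pi fun _ : Fin (n + 1) => μ) =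
        ∫ q, F (φ.symm q) ∂(μ.prod (Measure.pi fun _ : Fin n => μ)) := by
      rw [← e.integral_comp φ.measurableEmbedding]
      simp
    have hmap := e.map_eq
    rw [← hint, ← hmap] at hprod
    have := ProbabilityTheory.HasSubgaussianMGF.of_map φ.measurable.aemeasurable hprod
    have hc' : (c / 2) ^ 2 + n * (c / 2) ^ 2 = ((n + 1 : ℕ) : ℝ≥0) * (c / 2) ^ 2 := by
      push_cast; ring
    rw [hc'] at this
    simpa [Function.comp_def] using this

/-- McDiarmid's inequality for a function of two independent i.i.d. samples. -/
theorem measure_ge_le_of_bounded_differences {A B : Type*} [MeasurableSpace A]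
    [MeasurableSpace B] (μ : Measure A) (ν : Measure B) [IsProbabilityMeasure μ]
    [IsProbabilityMeasure ν] (n m : ℕ) {F : (Fin n → A) × (Fin m → B) → ℝ} (hF : Measurable F)
    {C : ℝ} (hC : ∀ p, |F p| ≤ C) {c d : ℝ≥0}
    (hc : ∀ x y i u, |F (Function.update x i u, y) - F (x, y)| ≤ c)
    (hd : ∀ x y j u, |F (x, Function.update y j u) - F (x, y)| ≤ d) {ε : ℝ} (hε : 0 ≤ ε) :
    ((Measure.pi fun _ : Fin n => μ).prod (Measure.pi fun _ : Fin m => ν)).real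
      {p | ε ≤ F p - ∫ q, F q ∂((Measure.pi fun _ : Fin n => μ).prod
        (Measure.pi fun _ : Fin m => ν))} ≤
      Real.exp (-(2 * ε ^ 2) / (n * c ^ 2 + m * d ^ 2)) := by
  have hFi : ∀ y, Integrable (fun x => F (x, y)) (Measure.pi fun _ : Fin n => μ) := fun y =>
    Integrable.of_bound (hF.comp measurable_prodMk_right).aestronglyMeasurable C
      (ae_of_all _ fun _ => hC _)
  have h := hasSubgaussianMGF_prod (Measure.pi fun _ : Fin n => μ)
    (Measure.pi fun _ : Fin m => ν) hF hC (c₁ := n * (c / 2) ^ 2) (c₂ := m * (d / 2) ^ 2)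
    (fun y => hasSubgaussianMGF_pi μ n (hF.comp measurable_prodMk_right) (fun _ => hC _)
      fun x i u => hc x y i u)
    (hasSubgaussianMGF_pi ν m (C := C) (hF.stronglyMeasurable.integral_prod_left'.measurable)
        (fun y =>
           abs_integral_le_of_abs_le fun _ => hC _)
        (fun y i u => by
          rw [← integral_sub (hFi _) (hFi _)]
          exact abs_integral_le_of_abs_le fun x => hd x y i u))
  refine (h.measure_ge_le hε).trans_eq ?_
  congr 1
  have : (2 : ℝ) * ((n * (c / 2) ^ 2 + m * (d / 2) ^ 2 : ℝ≥0) : ℝ) =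
      (n * c ^ 2 + m * d ^ 2) / 2 := by
    push_cast; ring
  rw [this, div_div_eq_mul_div]
  congr 1; ring

section Symmetrization

variable {Y : Type*} [MeasurableSpace Y] {ι : Type*}

theorem abs_avg_le {n : ℕ} {v : Fin n → ℝ} {C : ℝ} (hC : 0 ≤ C) (hv : ∀ k, |v k| ≤ C) :
    |(n : ℝ)⁻¹ * ∑ k, v k| ≤ C := by
  simpa [boolSign] using abs_avg_boolSign_le (fun _ => true) hC hv

theorem measurable_radAvg [Countable ι] {n : ℕ} {g : ι → Y → ℝ} (hg : ∀ i, Measurable (g i)) :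
    Measurable fun y : Fin n → Y => radAvg fun i k => g i (y k) := by
  unfold radAvg
  refine (Finset.measurable_sum _ fun σ _ => Measurable.iSup fun i => ?_).const_mul _
  exact (Finset.measurable_sum _ fun k _ =>
    ((hg i).comp (measurable_pi_apply k)).const_mul _).const_mul _

theorem integral_avg {P : Measure Y} [IsProbabilityMeasure P] {n : ℕ} (hn : 0 < n) {g : Y → ℝ}
    (hg : Integrable g P) :
    ∫ y, (n : ℝ)⁻¹ * ∑ k, g (y k) ∂(Measure.pi fun _ : Fin n => P) = ∫ y, g y ∂P := by
  have hmp := fun k : Fin n => measurePreserving_eval (fun _ : Fin n => P) k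
  have hk : ∀ k : Fin n, Integrable (fun y : Fin n → Y => g (y k))
      (Measure.pi fun _ : Fin n => P) := fun k =>
    (hmp k).integrable_comp_of_integrable hg
  have hn0 : (n : ℝ) ≠ 0 := by positivity
  rw [integral_const_mul, integral_finsetSum _ fun k _ => hk k]
  have : ∀ k : Fin n, ∫ y : Fin n → Y, g (y k) ∂(Measure.pi fun _ : Fin n => P) =
      ∫ y, g y ∂P := fun k =>
    integral_comp_eval (μ := fun _ : Fin n => P) (i := k) hg.aestronglyMeasurable
  simp [this, hn0]

/-- Symmetrization for the uniform deviation of empirical means. -/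
theorem integral_ciSup_integral_sub_avg_le [Nonempty ι] [Countable ι] (P : Measure Y)
    [IsProbabilityMeasure P] {n : ℕ} (hn : 0 < n) {g : ι → Y → ℝ} (hg : ∀ i, Measurable (g i))
    {C : ℝ} (hC : ∀ i y, |g i y| ≤ C) :
    ∫ y, ⨆ i, (∫ z, g i z ∂P - (n : ℝ)⁻¹ * ∑ k, g i (y k)) ∂(Measure.pi fun _ : Fin n => P) ≤
      2 * ∫ y, radAvg (fun i k => g i (y k)) ∂(Measure.pi fun _ : Fin n => P) := by
  set μ := Measure.pi fun _ : Fin n => P with hμ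
  obtain ⟨y₀⟩ : Nonempty Y := nonempty_of_isProbabilityMeasure P
  have hC0 : 0 ≤ C := (abs_nonneg _).trans (hC (Classical.arbitrary ι) y₀)
  have hgi : ∀ i, Integrable (g i) P := fun i =>
    Integrable.of_bound (hg i).aestronglyMeasurable C (ae_of_all _ (hC i))
  have hgk : ∀ i k, Measurable fun y : Fin n → Y => g i (y k) := fun i k =>
    (hg i).comp (measurable_pi_apply k)
  have hsub : ∀ i a b, |g i a - g i b| ≤ C + C := fun i a b =>
    (abs_sub _ _).trans (add_le_add (hC i a) (hC i b))
  let D : (Fin n → Bool) → (Fin n → Y) × (Fin n → Y) → ℝ := fun σ p =>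
    ⨆ i, (n : ℝ)⁻¹ * ∑ k, boolSign (σ k) * (g i (p.1 k) - g i (p.2 k))
  have hDm : ∀ σ, Measurable (D σ) := fun σ => Measurable.iSup fun i =>
    (Finset.measurable_sum _ fun k _ => (((hgk i k).comp measurable_fst).sub
      ((hgk i k).comp measurable_snd)).const_mul _).const_mul _
  have hDb : ∀ σ p, |D σ p| ≤ C + C := fun σ p =>
    abs_ciSup_le fun i => abs_avg_boolSign_le σ (by linarith) fun k => hsub i _ _
  have hDi : ∀ σ, Integrable (D σ) (μ.prod μ) := fun σ =>
    Integrable.of_bound (hDm σ).aestronglyMeasurable (C + C) (ae_of_all _ (hDb σ))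
  have hswap : ∀ σ, ∫ p, D σ p ∂(μ.prod μ) = ∫ p, D (fun _ => true) p ∂(μ.prod μ) := by
    intro σ
    have e := measurePreserving_arrowProdEquivProdArrow Y Y (Fin n) (fun _ => P) (fun _ => P)
    have hS : MeasurePreserving
        (fun (w : Fin n → Y × Y) k => (if σ k then id else Prod.swap) (w k))
        (Measure.pi fun _ => P.prod P) (Measure.pi fun _ => P.prod P) :=
      measurePreserving_pi _ _ (f := fun k => if σ k then id else Prod.swap) fun k => by
        split_ifs
        · exact MeasurePreserving.id _
        · exact Measure.measurePreserving_swap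
    have hcomp := e.comp hS
    have h1 := integral_map (μ := Measure.pi fun _ => P.prod P) e.measurable.aemeasurable (f := D σ)
      (hDm σ).aestronglyMeasurable
    have h2 := integral_map (μ := Measure.pi fun _ => P.prod P) hcomp.measurable.aemeasurable
      (f := D fun _ => true) (hDm fun _ => true).aestronglyMeasurable
    rw [e.map_eq] at h1
    rw [hcomp.map_eq] at h2
    rw [hμ, h1, h2]
    congr 1; ext w
    refine iSup_congr fun i => ?_
    congr 1
    refine Finset.sum_congr rfl fun k _ => ?_
    cases h : σ k <;>
      simp [boolSign, MeasurableEquiv.arrowProdEquivProdArrow, Equiv.arrowProdEquivProdArrow, h]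
  let R : (Fin n → Bool) → (Fin n → Y) → ℝ := fun σ y =>
    ⨆ i, (n : ℝ)⁻¹ * ∑ k, boolSign (σ k) * g i (y k)
  let R' : (Fin n → Bool) → (Fin n → Y) → ℝ := fun σ y =>
    ⨆ i, (n : ℝ)⁻¹ * ∑ k, boolSign (σ k) * -g i (y k)
  have hRi : ∀ σ, Integrable (R σ) μ := fun σ =>
    Integrable.of_bound (Measurable.iSup fun i => (Finset.measurable_sum _ fun k _ =>
      (hgk i k).const_mul _).const_mul _).aestronglyMeasurable C
      (ae_of_all _ fun y => abs_ciSup_le fun i => abs_avg_boolSign_le σ hC0 fun k => hC i _)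
  have hR'i : ∀ σ, Integrable (R' σ) μ := fun σ =>
    Integrable.of_bound (Measurable.iSup fun i => (Finset.measurable_sum _ fun k _ =>
      (hgk i k).neg.const_mul _).const_mul _).aestronglyMeasurable C
      (ae_of_all _ fun y => abs_ciSup_le fun i => abs_avg_boolSign_le σ hC0 fun k => by
        rw [abs_neg]; exact hC i _)
  have hDle : ∀ σ, ∫ p, D σ p ∂(μ.prod μ) ≤ ∫ y, R σ y ∂μ + ∫ y, R' σ y ∂μ := by
    intro σ
    have h1 : ∀ p, D σ p ≤ R σ p.1 + R' σ p.2 := fun p => by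
      refine (iSup_congr fun i => ?_).trans_le (ciSup_add_le_ciSup_add_ciSup
        (bddAbove_of_abs_le fun i => abs_avg_boolSign_le σ hC0 fun k => hC i (p.1 k))
        (bddAbove_of_abs_le fun i => abs_avg_boolSign_le σ (v := fun k => - g i (p.2 k)) hC0
          fun k => by rw [abs_neg]; exact hC i (p.2 k)))
      rw [← mul_add, ← Finset.sum_add_distrib]
      congr 1
      exact Finset.sum_congr rfl fun k _ => by ring
    refine (integral_mono (hDi σ) ((hRi σ).comp_fst μ |>.add ((hR'i σ).comp_snd μ)) h1).trans_eq ?_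
    simp only [Pi.add_apply]
    rw [integral_add ((hRi σ).comp_fst μ) ((hR'i σ).comp_snd μ), integral_fun_fst,
      integral_fun_snd]
    simp
  have h1 : ∫ y, ⨆ i, (∫ z, g i z ∂P - (n : ℝ)⁻¹ * ∑ k, g i (y k)) ∂μ ≤
      ∫ p, D (fun _ => true) p ∂(μ.prod μ) := by
    rw [integral_prod_symm _ (hDi _)]
    have hsi : ∀ i y, |∫ z, g i z ∂P - (n : ℝ)⁻¹ * ∑ k, g i ((y : Fin n → Y) k)| ≤ C + C :=
      fun i y => (abs_sub _ _).trans (add_le_add (abs_integral_le_of_abs_le (hC i))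
        (abs_avg_le hC0 fun k => hC i _))
    refine integral_mono (Integrable.of_bound (Measurable.iSup fun i =>
      ((Finset.measurable_sum _ fun k _ => hgk i k).const_mul _).const_sub _).aestronglyMeasurable
      (C + C) (ae_of_all _ fun y => abs_ciSup_le fun i => hsi i y)) (hDi _).integral_prod_right
      fun y => ciSup_le fun i => ?_
    have hai : Integrable (fun y : Fin n → Y => (n : ℝ)⁻¹ * ∑ k, g i (y k)) μ :=
      Integrable.of_bound ((Finset.measurable_sum _ fun k _ =>
        hgk i k).const_mul _).aestronglyMeasurable C
        (ae_of_all _ fun y => abs_avg_le hC0 fun k => hC i _)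
    have : ∫ z, g i z ∂P - (n : ℝ)⁻¹ * ∑ k, g i (y k) =
        ∫ y', ((n : ℝ)⁻¹ * ∑ k, g i (y' k) - (n : ℝ)⁻¹ * ∑ k, g i (y k)) ∂μ := by
      rw [integral_sub hai (integrable_const _), integral_avg hn (hgi i)]
      simp
    rw [this]
    refine integral_mono (hai.sub (integrable_const _))
      (Integrable.of_bound ((hDm _).comp measurable_prodMk_right).aestronglyMeasurable (C + C)
        (ae_of_all _ fun x => hDb _ (x, y))) fun x => ?_
    refine le_trans (le_of_eq ?_) (le_ciSup (bddAbove_of_abs_le fun i =>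
      abs_avg_boolSign_le (fun _ => true) (add_nonneg hC0 hC0) fun k => hsub i (x k) (y k)) i)
    simp [boolSign, mul_sub]
  have h2 : (2 ^ n : ℝ) * ∫ p, D (fun _ => true) p ∂(μ.prod μ) ≤
      (∑ σ, ∫ y, R σ y ∂μ) + ∑ σ, ∫ y, R' σ y ∂μ := by
    rw [← Finset.sum_add_distrib]
    refine le_trans (le_of_eq ?_) (Finset.sum_le_sum fun σ _ => hDle σ)
    simp [hswap]
  have h3 : ∫ y, radAvg (fun i k => g i (y k)) ∂μ = (2 ^ n : ℝ)⁻¹ * ∑ σ, ∫ y, R σ y ∂μ := by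
    simp only [radAvg]
    rw [integral_const_mul, integral_finsetSum _ fun σ _ => hRi σ]
  have h4 : ∫ y, radAvg (fun i k => g i (y k)) ∂μ = (2 ^ n : ℝ)⁻¹ * ∑ σ, ∫ y, R' σ y ∂μ := by
    simp only [← radAvg_neg fun i k => g i _]
    simp only [radAvg]
    rw [integral_const_mul, integral_finsetSum _ fun σ _ => hR'i σ]
  refine h1.trans ?_
  rw [two_mul]
  nth_rewrite 1 [h3]
  rw [h4, ← mul_add, le_inv_mul_iff₀ (by positivity)]
  exact h2

theorem integral_ciSup_avg_sub_integral_le [Nonempty ι] [Countable ι] (P : Measure Y)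
    [IsProbabilityMeasure P] {n : ℕ} (hn : 0 < n) {g : ι → Y → ℝ} (hg : ∀ i, Measurable (g i))
    {C : ℝ} (hC : ∀ i y, |g i y| ≤ C) :
    ∫ y, ⨆ i, ((n : ℝ)⁻¹ * ∑ k, g i (y k) - ∫ z, g i z ∂P) ∂(Measure.pi fun _ : Fin n => P) ≤
      2 * ∫ y, radAvg (fun i k => g i (y k)) ∂(Measure.pi fun _ : Fin n => P) := by
  have h := integral_ciSup_integral_sub_avg_le P hn (g := fun i y => -g i y)
    (fun i => (hg i).neg) (C := C) (fun i y => by rw [abs_neg]; exact hC i y)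
  simp only [radAvg_neg, integral_neg, Finset.sum_neg_distrib, mul_neg, sub_neg_eq_add] at h
  simpa only [sub_eq_neg_add] using h

end Symmetrization

section Conjugate

variable {f : ℝ → ℝ} {a : ℝ} {b : EReal}

theorem isOpen_Dom : IsOpen (Dom a b) :=
  isOpen_Ioi.inter (isOpen_Iio.preimage continuous_coe_real_ereal)

theorem rderiv_eq_derivWithin_Ioi (g : ℝ → ℝ) (z : ℝ) :
    rderiv g z = derivWithin g (Ioi z) z := (derivWithin_Ioi_eq_Ici g z).symm

/-- Right derivatives bound increments of convex functions from below. -/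
theorem ConvexOn.rderiv_mul_sub_le {S : Set ℝ} {g : ℝ → ℝ} (hg : ConvexOn ℝ S g) {x y : ℝ}
    (hx : x ∈ interior S) (hy : y ∈ S) : rderiv g x * (y - x) ≤ g y - g x := by
  rw [rderiv_eq_derivWithin_Ioi]
  rcases lt_trichotomy x y with h | rfl | h
  · have := hg.rightDeriv_le_slope_of_mem_interior hx hy h
    rw [slope_def_field, le_div_iff₀ (by linarith)] at this
    exact this
  · simp
  · have h1 := hg.slope_le_leftDeriv_of_mem_interior hy hx h
    have h2 := hg.leftDeriv_le_rightDeriv_of_mem_interior hx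
    have := h1.trans h2
    rw [slope_def_field, div_le_iff₀ (by linarith)] at this
    linarith

theorem le_fStar {t : ℝ} (ht : t ∈ Dom a b) (z : ℝ) : ((z * t - f t : ℝ) : EReal) ≤ fStar f a b z :=
  le_iSup₂_of_le t ht le_rfl

theorem fStar_le {z c : ℝ} (h : ∀ t ∈ Dom a b, z * t - f t ≤ c) : fStar f a b z ≤ c :=
  iSup₂_le fun t ht => EReal.coe_le_coe_iff.2 (h t ht)

theorem monotone_fStar (ha : 0 ≤ a) : Monotone (fStar f a b) := fun _ w hzw =>
  iSup₂_le fun _ ht => le_trans (EReal.coe_le_coe_iff.2 (sub_le_sub_right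
    (mul_le_mul_of_nonneg_right hzw (ha.trans ht.1.le)) _)) (le_fStar ht w)

theorem measurable_fStarR (ha : 0 ≤ a) : Measurable (fStarR f a b) :=
  (monotone_fStar ha).measurable.ereal_toReal

theorem self_le_fStar (h1 : 1 ∈ Dom a b) (hf1 : f 1 = 0) (z : ℝ) : (z : EReal) ≤ fStar f a b z := by
  simpa [hf1] using le_fStar (f := f) h1 z

theorem coe_fStarR (h1 : 1 ∈ Dom a b) (hf1 : f 1 = 0) {z : ℝ} (hz : fStar f a b z < ⊤) :
    (fStarR f a b z : EReal) = fStar f a b z :=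
  EReal.coe_toReal hz.ne fun h => by simpa [h] using self_le_fStar h1 hf1 z

theorem fStar_zz (h1 : 1 ∈ Dom a b) (hf1 : f 1 = 0) (hconv : ConvexOn ℝ (Dom a b) f) :
    fStar f a b (zz f) = zz f := by
  refine le_antisymm (fStar_le fun t ht => ?_) (self_le_fStar h1 hf1 _)
  have := hconv.rderiv_mul_sub_le (isOpen_Dom.interior_eq.symm ▸ h1) ht
  rw [hf1] at this
  change zz f * (t - 1) ≤ _ at this
  linarith

theorem convexOn_fStarR (h1 : 1 ∈ Dom a b) (hf1 : f 1 = 0) :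
    ConvexOn ℝ {z | fStar f a b z < ⊤} (fStarR f a b) := by
  have key : ∀ x ∈ {z | fStar f a b z < ⊤}, ∀ y ∈ {z | fStar f a b z < ⊤}, ∀ r s : ℝ, 0 ≤ r →
      0 ≤ s → r + s = 1 → fStar f a b (r * x + s * y) ≤
        ((r * fStarR f a b x + s * fStarR f a b y : ℝ) : EReal) := by
    intro x hx y hy r s hr hs hrs
    refine fStar_le fun t ht => ?_
    have e1 := le_fStar (f := f) ht x
    have e2 := le_fStar (f := f) ht y
    rw [← coe_fStarR h1 hf1 hx, EReal.coe_le_coe_iff] at e1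
    rw [← coe_fStarR h1 hf1 hy, EReal.coe_le_coe_iff] at e2
    calc (r * x + s * y) * t - f t = r * (x * t - f t) + s * (y * t - f t) := by
          linear_combination (f t) * hrs
      _ ≤ _ := by gcongr
  have hmem : ∀ x ∈ {z | fStar f a b z < ⊤}, ∀ y ∈ {z | fStar f a b z < ⊤}, ∀ r s : ℝ, 0 ≤ r →
      0 ≤ s → r + s = 1 → fStar f a b (r * x + s * y) < ⊤ := fun x hx y hy r s hr hs hrs =>
    (key x hx y hy r s hr hs hrs).trans_lt (EReal.coe_lt_top _)
  refine ⟨fun x hx y hy r s hr hs hrs => hmem x hx y hy r s hr hs hrs,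
    fun x hx y hy r s hr hs hrs => ?_⟩
  have := key x hx y hy r s hr hs hrs
  rw [← coe_fStarR h1 hf1 (hmem x hx y hy r s hr hs hrs), EReal.coe_le_coe_iff] at this
  exact this

theorem mem_interior_finite_of_le (ha : 0 ≤ a) {z w : ℝ}
    (hw : w ∈ interior {z | fStar f a b z < ⊤}) (hzw : z ≤ w) :
    z ∈ interior {z | fStar f a b z < ⊤} := by
  rw [mem_interior_iff_mem_nhds, Metric.mem_nhds_iff] at *
  obtain ⟨δ, hδ, h⟩ := hw
  refine ⟨δ, hδ, fun x hx => ?_⟩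
  have hxS : x + (w - z) ∈ Metric.ball w δ := by
    rw [Metric.mem_ball, Real.dist_eq] at *
    convert hx using 2
    ring
  exact (monotone_fStar ha (by linarith)).trans_lt (h hxS)

/-- The properties of the conjugate function on `[p - w, p + w]` used for concentration:
convexity, monotonicity, a supporting line of slope one at `p`, and the Lipschitz constant `M`. -/
structure IsConjOn (φ : ℝ → ℝ) (p w M : ℝ) : Prop where
  measurable : Measurable φ
  convexOn : ConvexOn ℝ (Icc (p - w) (p + w)) φ
  monotoneOn : MonotoneOn φ (Icc (p - w) (p + w))
  self_le : ∀ z ∈ Icc (p - w) (p + w), z ≤ φ z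
  apply_self : φ p = p
  nonneg : 0 ≤ M
  lipschitz : ∀ x ∈ Icc (p - w) (p + w), ∀ y ∈ Icc (p - w) (p + w), |φ x - φ y| ≤ M * |x - y|

/-- The standing assumptions on `f` at the base point `1`. -/
structure IsGenerator (f : ℝ → ℝ) (a : ℝ) (b : EReal) (w : ℝ) : Prop where
  nonneg : 0 ≤ a
  one_mem : 1 ∈ Dom a b
  convexOn : ConvexOn ℝ (Dom a b) f
  apply_one : f 1 = 0
  pos : 0 < w
  mem_interior : zz f + w ∈ interior {z : ℝ | fStar f a b z < ⊤}

variable {w : ℝ}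

theorem IsGenerator.mem_interior_of_mem_Icc (h : IsGenerator f a b w) {z : ℝ}
    (hz : z ∈ Icc (zz f - w) (zz f + w)) : z ∈ interior {z : ℝ | fStar f a b z < ⊤} :=
  mem_interior_finite_of_le h.nonneg h.mem_interior hz.2

theorem IsGenerator.fStar_lt_top (h : IsGenerator f a b w) {z : ℝ}
    (hz : z ∈ Icc (zz f - w) (zz f + w)) : fStar f a b z < ⊤ :=
  interior_subset (s := {z : ℝ | fStar f a b z < ⊤}) (h.mem_interior_of_mem_Icc hz)

theorem IsGenerator.rderiv_mul_sub_le (h : IsGenerator f a b w) {x y : ℝ}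
    (hx : x ∈ Icc (zz f - w) (zz f + w)) (hy : y ∈ Icc (zz f - w) (zz f + w)) :
    rderiv (fStarR f a b) x * (y - x) ≤ fStarR f a b y - fStarR f a b x :=
  (convexOn_fStarR h.one_mem h.apply_one).rderiv_mul_sub_le (h.mem_interior_of_mem_Icc hx)
    (h.fStar_lt_top hy)

theorem IsGenerator.monotoneOn (h : IsGenerator f a b w) :
    MonotoneOn (fStarR f a b) (Icc (zz f - w) (zz f + w)) := by
  intro x hx y hy hxy
  have := monotone_fStar (f := f) (b := b) h.nonneg hxy
  rwa [← coe_fStarR h.one_mem h.apply_one (h.fStar_lt_top hx),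
    ← coe_fStarR h.one_mem h.apply_one (h.fStar_lt_top hy), EReal.coe_le_coe_iff] at this

theorem IsGenerator.fStarR_zz (h : IsGenerator f a b w) : fStarR f a b (zz f) = zz f := by
  rw [fStarR, fStar_zz h.one_mem h.apply_one h.convexOn, EReal.toReal_coe]

theorem IsGenerator.self_le_fStarR (h : IsGenerator f a b w) {z : ℝ} (hz : fStar f a b z < ⊤) :
    z ≤ fStarR f a b z := by
  have := self_le_fStar (b := b) h.one_mem h.apply_one z
  rwa [← coe_fStarR h.one_mem h.apply_one hz, EReal.coe_le_coe_iff] at this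

/-- A convex function with one-sided derivatives in `[lo, hi]` at the endpoints of an interval is
Lipschitz there; here in the form needed for `f*` and `f* - id`. -/
theorem IsGenerator.abs_sub_le (h : IsGenerator f a b w) {c L : ℝ}
    (hL : ∀ z ∈ Icc (zz f - w) (zz f + w), |rderiv (fStarR f a b) z - c| ≤ L) {x y : ℝ}
    (hx : x ∈ Icc (zz f - w) (zz f + w)) (hy : y ∈ Icc (zz f - w) (zz f + w)) :
    |(fStarR f a b x - c * x) - (fStarR f a b y - c * y)| ≤ L * |x - y| := by
  wlog hxy : x ≤ y generalizing x y
  · rw [abs_sub_comm, abs_sub_comm x]; exact this hy hx (le_of_not_ge hxy)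
  have h1 := h.rderiv_mul_sub_le hx hy
  have h2 := h.rderiv_mul_sub_le hy hx
  have h3 := mul_le_mul_of_nonneg_right (abs_le.1 (hL x hx)).1 (sub_nonneg.2 hxy)
  have h4 := mul_le_mul_of_nonneg_right (abs_le.1 (hL y hy)).2 (sub_nonneg.2 hxy)
  rw [abs_sub_comm x, abs_of_nonneg (sub_nonneg.2 hxy), abs_le]
  constructor <;> nlinarith

theorem IsGenerator.rderiv_le (h : IsGenerator f a b w) {x y : ℝ}
    (hx : x ∈ Icc (zz f - w) (zz f + w)) (hy : y ∈ Icc (zz f - w) (zz f + w)) (hxy : x ≤ y) :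
    rderiv (fStarR f a b) x ≤ rderiv (fStarR f a b) y := by
  rcases hxy.eq_or_lt with rfl | hlt
  · rfl
  have h1 := h.rderiv_mul_sub_le hx hy
  have h2 := h.rderiv_mul_sub_le hy hx
  nlinarith

theorem IsGenerator.right_mem (h : IsGenerator f a b w) : zz f + w ∈ Icc (zz f - w) (zz f + w) :=
  ⟨by linarith [h.pos], le_rfl⟩

theorem IsGenerator.zz_mem (h : IsGenerator f a b w) : zz f ∈ Icc (zz f - w) (zz f + w) :=
  ⟨by linarith [h.pos], by linarith [h.pos]⟩

theorem IsGenerator.rderiv_nonneg (h : IsGenerator f a b w) {z : ℝ}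
    (hz : z ∈ Icc (zz f - w) (zz f + w)) : 0 ≤ rderiv (fStarR f a b) z := by
  have hcv := convexOn_fStarR (b := b) h.one_mem h.apply_one
  have hlt : z - 1 < z := by linarith
  have hmem : fStar f a b (z - 1) < ⊤ :=
    (monotone_fStar h.nonneg hlt.le).trans_lt (h.fStar_lt_top hz)
  have h1 := hcv.rderiv_mul_sub_le (h.mem_interior_of_mem_Icc hz) hmem
  have h2 := monotone_fStar (f := f) (b := b) h.nonneg hlt.le
  rw [← coe_fStarR h.one_mem h.apply_one (h.fStar_lt_top hz),
    ← coe_fStarR h.one_mem h.apply_one hmem, EReal.coe_le_coe_iff] at h2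
  linarith

theorem IsGenerator.isConjOn (h : IsGenerator f a b w) :
    IsConjOn (fStarR f a b) (zz f) w (rderiv (fStarR f a b) (zz f + w)) where
  measurable := measurable_fStarR h.nonneg
  convexOn := (convexOn_fStarR h.one_mem h.apply_one).subset (fun _ hz => h.fStar_lt_top hz)
    (convex_Icc _ _)
  monotoneOn := h.monotoneOn
  self_le _ hz := h.self_le_fStarR (h.fStar_lt_top hz)
  apply_self := h.fStarR_zz
  nonneg := h.rderiv_nonneg h.right_mem
  lipschitz x hx y hy := by
    simpa using h.abs_sub_le (c := 0) (fun z hz => by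
      rw [sub_zero, abs_of_nonneg (h.rderiv_nonneg hz)]
      exact h.rderiv_le hz h.right_mem hz.2) hx hy

/-- If the right derivative of `f*` is `L`-Lipschitz then it differs from its value `1` at `z₀`
by at most `L * w`. -/
theorem IsGenerator.abs_rderiv_sub_one_le (h : IsGenerator f a b w) {L : ℝ≥0}
    (hL : LipschitzOnWith L (rderiv (fStarR f a b)) (Icc (zz f - w) (zz f + w))) {z : ℝ}
    (hz : z ∈ Icc (zz f - w) (zz f + w)) : |rderiv (fStarR f a b) z - 1| ≤ L * w := by
  have hle : ∀ x ∈ Icc (zz f - w) (zz f + w), x < zz f → rderiv (fStarR f a b) x ≤ 1 := by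
    intro x hx hlt
    have h1 := h.rderiv_mul_sub_le hx h.zz_mem
    have h2 := h.self_le_fStarR (h.fStar_lt_top hx)
    rw [h.fStarR_zz] at h1
    have h3 : 0 < zz f - x := by linarith
    nlinarith
  have hge : 1 ≤ rderiv (fStarR f a b) (zz f) := by
    have h0 : rderiv (fStarR f a b) (zz f) =
      sInf (slope (fStarR f a b) (zz f) '' {y | y ∈ {z | fStar f a b z < ⊤} ∧ zz f < y}) := by
      rw [rderiv_eq_derivWithin_Ioi]
      exact (convexOn_fStarR h.one_mem h.apply_one).rightDeriv_eq_sInf_slope_of_mem_interior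
        (h.mem_interior_of_mem_Icc h.zz_mem)
    rw [h0]
    refine le_csInf ⟨_, zz f + w, ⟨h.fStar_lt_top h.right_mem, by linarith [h.pos]⟩, rfl⟩ ?_
    rintro _ ⟨y, ⟨hy, hlt⟩, rfl⟩
    rw [slope_def_field, le_div_iff₀ (by linarith), h.fStarR_zz]
    linarith [h.self_le_fStarR hy]
  have hone : rderiv (fStarR f a b) (zz f) = 1 := by
    refine le_antisymm (le_of_forall_pos_le_add fun ε hε => ?_) hge
    have hw := h.pos
    set δ := min w (ε / (L + 1))
    have hL0 : (0 : ℝ) < L + 1 := by positivity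
    have hδ0 : 0 < δ := lt_min hw (by positivity)
    have hx : zz f - δ ∈ Icc (zz f - w) (zz f + w) :=
      ⟨by linarith [min_le_left w (ε / (L + 1))], by linarith⟩
    have h1 := hL.dist_le_mul _ h.zz_mem _ hx
    rw [Real.dist_eq, Real.dist_eq, sub_sub_cancel, abs_of_pos hδ0] at h1
    have h2 := hle _ hx (by linarith)
    have h3 : (L + 1) * δ ≤ ε := by
      rw [← le_div_iff₀' hL0]; exact min_le_right _ _
    have h4 := le_abs_self (rderiv (fStarR f a b) (zz f) - rderiv (fStarR f a b) (zz f - δ))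
    nlinarith
  have := hL.dist_le_mul _ hz _ h.zz_mem
  rw [Real.dist_eq, Real.dist_eq, hone] at this
  refine this.trans (mul_le_mul_of_nonneg_left ?_ L.2)
  exact abs_le.2 ⟨by linarith [hz.1], by linarith [hz.2]⟩

end Conjugate

section Shift

/-- A conjugate function `φ` near `p` together with a sequence `ν` of shifts, dense in the interval
of shifts relevant for functions with values in `[α, β]`. -/
structure IsShiftData (φ : ℝ → ℝ) (ν : ℕ → ℝ) (p α β M : ℝ) : Prop where
  conj : IsConjOn φ p (β - α) M
  mem : ∀ k, ν k ∈ Icc (α - p) (β - p)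
  dense : Icc (α - p) (β - p) ⊆ closure (range ν)
  lt : α < β

/-- The infimum over the shifts `ν k` defining `Λ_f^P[h]`. -/
noncomputable def shiftInf {X : Type*} [MeasurableSpace X] (φ : ℝ → ℝ) (ν : ℕ → ℝ) (P : Measure X)
    (h : X → ℝ) : ℝ :=
  ⨅ k, (ν k + ∫ x, φ (h x - ν k) ∂P)

variable {X : Type*} [MeasurableSpace X] {φ : ℝ → ℝ} {ν : ℕ → ℝ} {p α β M : ℝ}
  {P P' : Measure X} [IsProbabilityMeasure P] {h h' : X → ℝ}

theorem sub_mem_Icc_of_mem {u s : ℝ} (hu : u ∈ Icc α β) (hs : s ∈ Icc (α - p) (β - p)) :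
    u - s ∈ Icc (p - (β - α)) (p + (β - α)) :=
  ⟨by linarith [hu.1, hs.2], by linarith [hu.2, hs.1]⟩

theorem integrable_of_mem_Icc (hm : Measurable h) (hb : ∀ x, h x ∈ Icc α β) : Integrable h P :=
  Integrable.of_mem_Icc α β hm.aemeasurable (ae_of_all _ hb)

namespace IsShiftData

theorem abs_apply_le (D : IsShiftData φ ν p α β M) {z : ℝ}
    (hz : z ∈ Icc (p - (β - α)) (p + (β - α))) : |φ z| ≤ |p| + M * (β - α) := by
  have hlt := D.lt
  have h1 := D.conj.lipschitz z hz p ⟨by linarith, by linarith⟩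
  rw [D.conj.apply_self] at h1
  have h2 : |z - p| ≤ β - α := abs_le.2 ⟨by linarith [hz.1], by linarith [hz.2]⟩
  have h3 := mul_le_mul_of_nonneg_left h2 D.conj.nonneg
  have h4 := abs_add_le (φ z - p) p
  rw [sub_add_cancel] at h4
  linarith

theorem integrable (D : IsShiftData φ ν p α β M) (hm : Measurable h) (hb : ∀ x, h x ∈ Icc α β)
    {s : ℝ} (hs : s ∈ Icc (α - p) (β - p)) : Integrable (fun x => φ (h x - s)) P :=
  Integrable.of_bound (D.conj.measurable.comp (hm.sub_const s)).aestronglyMeasurable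
    (|p| + M * (β - α))
    (ae_of_all _ fun x => D.abs_apply_le (sub_mem_Icc_of_mem (hb x) hs))

theorem integral_le (D : IsShiftData φ ν p α β M) (hm : Measurable h) (hb : ∀ x, h x ∈ Icc α β)
    {s : ℝ} (hs : s ∈ Icc (α - p) (β - p)) : ∫ x, h x ∂P ≤ s + ∫ x, φ (h x - s) ∂P := by
  have hint := integrable_of_mem_Icc (P := P) hm hb
  have := integral_mono (hint.sub (integrable_const s)) (D.integrable (P := P) hm hb hs)
    fun x => D.conj.self_le _ (sub_mem_Icc_of_mem (hb x) hs)
  simp only [Pi.sub_apply] at this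
  rw [integral_sub hint (integrable_const s)] at this
  simp only [integral_const, probReal_univ, one_smul] at this
  linarith

theorem le_integral (hm : Measurable h) (hb : ∀ x, h x ∈ Icc α β) : α ≤ ∫ x, h x ∂P := by
  have := integral_mono (integrable_const α) (integrable_of_mem_Icc (P := P) hm hb)
    fun x => (hb x).1
  simpa using this

theorem integral_le_right (hm : Measurable h) (hb : ∀ x, h x ∈ Icc α β) : ∫ x, h x ∂P ≤ β := by
  have := integral_mono (integrable_of_mem_Icc (P := P) hm hb) (integrable_const β)
    fun x => (hb x).2
  simpa using this

theorem bddBelow (D : IsShiftData φ ν p α β M) (hm : Measurable h) (hb : ∀ x, h x ∈ Icc α β) :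
    BddBelow (range fun k => ν k + ∫ x, φ (h x - ν k) ∂P) := by
  refine ⟨α, ?_⟩
  rintro _ ⟨k, rfl⟩
  exact (le_integral hm hb).trans (D.integral_le hm hb (D.mem k))

theorem le_shiftInf (D : IsShiftData φ ν p α β M) (hm : Measurable h) (hb : ∀ x, h x ∈ Icc α β) :
    α ≤ shiftInf φ ν P h :=
  le_ciInf fun k => (le_integral hm hb).trans (D.integral_le hm hb (D.mem k))

theorem abs_integral_sub_le (D : IsShiftData φ ν p α β M) (hm : Measurable h)
    (hb : ∀ x, h x ∈ Icc α β) (hm' : Measurable h') (hb' : ∀ x, h' x ∈ Icc α β)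
    {s t : ℝ} (hs : s ∈ Icc (α - p) (β - p)) (ht : t ∈ Icc (α - p) (β - p)) :
    |(∫ x, φ (h x - s) ∂P) - ∫ x, φ (h' x - t) ∂P| ≤
      M * ((∫ x, |h x - h' x| ∂P) + |s - t|) := by
  have hd : Integrable (fun x => |h x - h' x|) P :=
    ((integrable_of_mem_Icc hm hb).sub (integrable_of_mem_Icc hm' hb')).abs
  rw [← integral_sub (D.integrable hm hb hs) (D.integrable hm' hb' ht)]
  calc _ ≤ ∫ x, |φ (h x - s) - φ (h' x - t)| ∂P := abs_integral_le_integral_abs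
    _ ≤ ∫ x, M * (|h x - h' x| + |s - t|) ∂P := by
        refine integral_mono ((D.integrable hm hb hs).sub (D.integrable hm' hb' ht)).abs
          ((hd.add (integrable_const _)).const_mul M) fun x => ?_
        refine (D.conj.lipschitz _ (sub_mem_Icc_of_mem (hb x) hs) _
          (sub_mem_Icc_of_mem (hb' x) ht)).trans (mul_le_mul_of_nonneg_left ?_ D.conj.nonneg)
        rw [sub_sub_sub_comm]
        exact abs_sub _ _
    _ = _ := by
        rw [integral_const_mul, integral_add hd (integrable_const _)]
        simp

theorem shiftInf_le (D : IsShiftData φ ν p α β M) (hm : Measurable h) (hb : ∀ x, h x ∈ Icc α β)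
    {s : ℝ} (hs : s ∈ Icc (α - p) (β - p)) :
    shiftInf φ ν P h ≤ s + ∫ x, φ (h x - s) ∂P := by
  refine le_of_forall_pos_le_add fun ε hε => ?_
  have hM := D.conj.nonneg
  obtain ⟨_, ⟨k, rfl⟩, hk⟩ := Metric.mem_closure_iff.1 (D.dense hs) (ε / (1 + M)) (by positivity)
  rw [Real.dist_eq, lt_div_iff₀ (by positivity)] at hk
  have h1 := D.abs_integral_sub_le (P := P) hm hb hm hb hs (D.mem k)
  simp only [sub_self, abs_zero, integral_zero, zero_add] at h1
  have h2 : shiftInf φ ν P h ≤ ν k + ∫ x, φ (h x - ν k) ∂P := ciInf_le (D.bddBelow hm hb) k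
  have h3 := (abs_le.1 h1).1
  have h4 := (abs_le.1 (le_refl |s - ν k|)).1
  linarith

theorem shiftInf_le_right (D : IsShiftData φ ν p α β M) (hm : Measurable h)
    (hb : ∀ x, h x ∈ Icc α β) : shiftInf φ ν P h ≤ β := by
  have hlt := D.lt
  have hs : β - p ∈ Icc (α - p) (β - p) := ⟨by linarith, le_rfl⟩
  refine (D.shiftInf_le hm hb hs).trans ?_
  have := integral_mono (D.integrable (P := P) hm hb hs) (integrable_const p) fun x => by
    have := D.conj.monotoneOn (sub_mem_Icc_of_mem (hb x) hs)
      (⟨by linarith, by linarith⟩ : p ∈ Icc (p - (β - α)) (p + (β - α))) (by linarith [(hb x).2])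
    rwa [D.conj.apply_self] at this
  simp only [integral_const, probReal_univ, one_smul] at this
  linarith

theorem shiftInf_le_add (D : IsShiftData φ ν p α β M) (hm : Measurable h)
    (hb : ∀ x, h x ∈ Icc α β) {c : ℝ}
    (hc : ∀ k, ∫ x, φ (h x - ν k) ∂P ≤ (∫ x, φ (h' x - ν k) ∂P') + c) :
    shiftInf φ ν P h ≤ shiftInf φ ν P' h' + c := by
  rw [← sub_le_iff_le_add]
  refine le_ciInf fun k => ?_
  have h1 : shiftInf φ ν P h ≤ ν k + ∫ x, φ (h x - ν k) ∂P := ciInf_le (D.bddBelow hm hb) k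
  linarith [hc k]

theorem abs_shiftInf_sub_le (D : IsShiftData φ ν p α β M) (hm : Measurable h)
    (hb : ∀ x, h x ∈ Icc α β) (hm' : Measurable h') (hb' : ∀ x, h' x ∈ Icc α β) :
    |shiftInf φ ν P h - shiftInf φ ν P h'| ≤ M * ∫ x, |h x - h' x| ∂P := by
  have key := fun k => D.abs_integral_sub_le (P := P) hm hb hm' hb' (D.mem k) (D.mem k)
  simp only [sub_self, abs_zero, add_zero] at key
  rw [abs_sub_le_iff, sub_le_iff_le_add', sub_le_iff_le_add']
  exact ⟨D.shiftInf_le_add hm hb fun k => by linarith [(abs_le.1 (key k)).2],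
    D.shiftInf_le_add hm' hb' fun k => by linarith [(abs_le.1 (key k)).1]⟩

end IsShiftData

theorem IsGenerator.cgf_eq {f : ℝ → ℝ} {a : ℝ} {b : EReal} (hf : IsGenerator f a b (β - α))
    (D : IsShiftData (fStarR f a b) ν (zz f) α β M) (hm : Measurable h)
    (hb : ∀ x, h x ∈ Icc α β) :
    cgf f a b P h = shiftInf (fStarR f a b) ν P h := by
  have hlt := D.lt
  have hle : ∀ k, cgf f a b P h ≤ ((ν k + ∫ x, fStarR f a b (h x - ν k) ∂P : ℝ) : EReal) := by
    intro k
    refine (iInf_le _ (ν k)).trans_eq ?_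
    rw [eIntegral, if_pos ⟨ae_of_all _ fun x =>
      (hf.fStar_lt_top (sub_mem_Icc_of_mem (hb x) (D.mem k))).ne,
      D.integrable hm hb (D.mem k)⟩, EReal.coe_add]
    rfl
  have hge : (shiftInf (fStarR f a b) ν P h : EReal) ≤ cgf f a b P h := by
    refine le_iInf fun s => ?_
    rw [eIntegral]
    split_ifs with hfin
    swap
    · rw [EReal.coe_add_top]
      exact le_top
    rw [← EReal.coe_add, EReal.coe_le_coe_iff]
    set t := max (α - zz f) (min s (β - zz f)) with ht
    have htm : t ∈ Icc (α - zz f) (β - zz f) :=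
      ⟨le_max_left _ _, max_le (by linarith) (min_le_right _ _)⟩
    refine (D.shiftInf_le hm hb htm).trans ?_
    have hi := D.integrable (P := P) hm hb htm
    have := integral_mono_ae (hi.add (integrable_const t)) (hfin.2.add (integrable_const s)) <| by
      filter_upwards [hfin.1] with x hx
      have hxlt : fStar f a b (h x - s) < ⊤ := lt_top_iff_ne_top.2 hx
      have hcv : ConvexOn ℝ {z | fStar f a b z < ⊤} fun z => fStarR f a b z - z :=
        (convexOn_fStarR hf.one_mem hf.apply_one).sub
          (concaveOn_id (convexOn_fStarR hf.one_mem hf.apply_one).1)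
      have hp := hf.fStar_lt_top hf.zz_mem
      have h0 := hf.self_le_fStarR hxlt
      have hmax : fStarR f a b (h x - t) - (h x - t) ≤
          max (fStarR f a b (zz f) - zz f) (fStarR f a b (h x - s) - (h x - s)) := by
        refine hcv.le_max_of_mem_segment hp hxlt ?_
        rw [segment_eq_uIcc]
        have h1 := (hb x).1
        have h2 := (hb x).2
        rcases le_total s (β - zz f) with h3 | h3
        · rw [min_eq_left h3] at ht
          rcases le_total (α - zz f) s with h4 | h4
          · rw [max_eq_right h4] at ht
            rw [ht]
            exact right_mem_uIcc
          · rw [max_eq_left h4] at ht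
            rw [uIcc_of_le (by linarith)]
            constructor <;> linarith
        · rw [min_eq_right h3, max_eq_right (by linarith)] at ht
          rw [uIcc_of_ge (by linarith)]
          constructor <;> linarith
      rw [hf.fStarR_zz, sub_self, max_eq_right (by linarith)] at hmax
      change fStarR f a b (h x - t) + t ≤ fStarR f a b (h x - s) + s
      linarith
    simp only [Pi.add_apply] at this
    rw [integral_add hi (integrable_const _)] at this
    have h2 := integral_add hfin.2 (integrable_const (μ := P) s)
    have h3 : ∫ x, (fStar f a b (h x - s)).toReal + s ∂P =
      (∫ x, (fStar f a b (h x - s)).toReal ∂P) + s := by simpa using h2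
    simp only [integral_const, probReal_univ, one_smul] at this
    rw [h3] at this
    linarith
  refine le_antisymm ?_ hge
  have hbot : cgf f a b P h ≠ ⊥ := fun hh => by simp [hh] at hge
  have htop : cgf f a b P h ≠ ⊤ := ((hle 0).trans_lt (EReal.coe_lt_top _)).ne
  rw [← EReal.coe_toReal htop hbot, EReal.coe_le_coe_iff]
  refine le_ciInf fun k => ?_
  rw [← EReal.coe_le_coe_iff, EReal.coe_toReal htop hbot]
  exact hle k

theorem IsGenerator.cgfR_eq {f : ℝ → ℝ} {a : ℝ} {b : EReal} (hf : IsGenerator f a b (β - α))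
    (D : IsShiftData (fStarR f a b) ν (zz f) α β M) (hm : Measurable h)
    (hb : ∀ x, h x ∈ Icc α β) :
    cgfR f a b P h = shiftInf (fStarR f a b) ν P h := by
  rw [cgfR, hf.cgf_eq D hm hb, EReal.toReal_coe]

end Shift

section Empirical

variable {X : Type*} [MeasurableSpace X]

theorem isProbabilityMeasure_empMeas {n : ℕ} (hn : 0 < n) (x : Fin n → X) :
    IsProbabilityMeasure (empMeas n x) := by
  constructor
  simp only [empMeas, Measure.smul_apply, Measure.finsetSum_apply, measure_univ, Finset.sum_const,
    Finset.card_univ, Fintype.card_fin, nsmul_eq_mul, mul_one, smul_eq_mul]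
  exact ENNReal.inv_mul_cancel (by exact_mod_cast hn.ne') (ENNReal.natCast_ne_top n)

theorem integral_empMeas {n : ℕ} (x : Fin n → X) {g : X → ℝ} (hg : Measurable g) :
    ∫ y, g y ∂(empMeas n x) = (n : ℝ)⁻¹ * ∑ k, g (x k) := by
  rw [empMeas, integral_smul_measure, integral_finsetSum_measure]
  · simp [integral_dirac' _ _ hg.stronglyMeasurable]
  · intro k _
    refine ⟨hg.aestronglyMeasurable, ?_⟩
    rw [HasFiniteIntegral, lintegral_dirac' _ hg.enorm]
    exact enorm_lt_top

theorem shiftInf_empMeas {n : ℕ} {φ : ℝ → ℝ} {ν : ℕ → ℝ} (hφ : Measurable φ) (x : Fin n → X)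
    {h : X → ℝ} (hm : Measurable h) :
    shiftInf φ ν (empMeas n x) h = shiftInf φ ν (empMeas n id) fun k => h (x k) := by
  refine iInf_congr fun k => ?_
  rw [integral_empMeas x (g := fun y => φ (h y - ν k)) (hφ.comp (hm.sub_const _)),
    integral_empMeas (id : Fin n → Fin n) (g := fun j => φ (h (x j) - ν k)) (by fun_prop)]
  rfl

/-- Convexity in the form of a two-point majorization inequality. -/
theorem ConvexOn.add_le_add_of_add_eq {S : Set ℝ} {φ : ℝ → ℝ} (hφ : ConvexOn ℝ S φ)
    {s t x y : ℝ} (hs : s ∈ S) (ht : t ∈ S) (hx : x ∈ Icc s t) (hxy : x + y = s + t) :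
    φ x + φ y ≤ φ s + φ t := by
  rcases hx.1.trans hx.2 |>.eq_or_lt with rfl | hlt
  · obtain rfl : x = s := le_antisymm hx.2 hx.1
    obtain rfl : y = x := by linarith
    rfl
  have hd : 0 < t - s := sub_pos.2 hlt
  have h0 : 0 ≤ (t - x) / (t - s) := div_nonneg (by linarith [hx.2]) hd.le
  have h1 : 0 ≤ (x - s) / (t - s) := div_nonneg (by linarith [hx.1]) hd.le
  have hsum : (t - x) / (t - s) + (x - s) / (t - s) = 1 := by field_simp; ring
  have e1 := hφ.2 hs ht h0 h1 hsum
  have e2 := hφ.2 hs ht h1 h0 (by rw [add_comm]; exact hsum)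
  simp only [smul_eq_mul] at e1 e2
  have r1 : (t - x) / (t - s) * s + (x - s) / (t - s) * t = x := by field_simp; ring
  have r2 : (x - s) / (t - s) * s + (t - x) / (t - s) * t = y := by
    obtain rfl : y = s + t - x := by linarith
    field_simp; ring
  rw [r1] at e1
  rw [r2] at e2
  calc φ x + φ y ≤ _ := add_le_add e1 e2
    _ = ((t - x) / (t - s) + (x - s) / (t - s)) * (φ s + φ t) := by ring
    _ = _ := by rw [hsum, one_mul]

variable {φ : ℝ → ℝ} {ν : ℕ → ℝ} {p α β M : ℝ}

/-- Submodularity of `(u, s) ↦ φ (u - s)`. -/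
theorem IsShiftData.add_apply_le (D : IsShiftData φ ν p α β M) {u v s t : ℝ}
    (hu : u ∈ Icc α β) (hv : v ∈ Icc α β) (hs : s ∈ Icc (α - p) (β - p))
    (ht : t ∈ Icc (α - p) (β - p)) :
    φ (max u v - max s t) + φ (min u v - min s t) ≤ φ (u - s) + φ (v - t) := by
  have J := @sub_mem_Icc_of_mem p α β
  rcases le_total u v with h1 | h1 <;> rcases le_total s t with h2 | h2 <;>
    simp only [h1, h2, max_eq_left, max_eq_right, min_eq_left, min_eq_right]
  · rw [add_comm]
  · exact D.conj.convexOn.add_le_add_of_add_eq (J hu hs) (J hv ht)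
      ⟨by linarith, by linarith⟩ (by ring)
  · rw [add_comm (φ (u - s))]
    exact D.conj.convexOn.add_le_add_of_add_eq (J hv ht) (J hu hs)
      ⟨by linarith, by linarith⟩ (by ring)
  · rfl

/-- The optimal bound on the effect of replacing one sample. -/
theorem IsShiftData.shiftInf_update_le (D : IsShiftData φ ν p α β M) {n : ℕ} (hn : 0 < n)
    {v : Fin n → ℝ} (hv : ∀ k, v k ∈ Icc α β) (i : Fin n) {u z : ℝ} (hu : u ∈ Icc α β)
    (hz : z ∈ Icc (p - (β - α)) p) :
    shiftInf φ ν (empMeas n id) (Function.update v i u) ≤ shiftInf φ ν (empMeas n id) v +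
      (-z + ((n : ℝ) - 1) / n * φ z + 1 / n * φ (β - α + z)) := by
  have hP := isProbabilityMeasure_empMeas hn (id : Fin n → Fin n)
  have hlt := D.lt
  have hα : α ∈ Icc α β := ⟨le_rfl, hlt.le⟩
  have hβ : β ∈ Icc α β := ⟨hlt.le, le_rfl⟩
  have hs : α - z ∈ Icc (α - p) (β - p) := ⟨by linarith [hz.2], by linarith [hz.1]⟩
  have hmeas : ∀ g : Fin n → ℝ, Measurable g := fun g => measurable_of_finite g
  set e : Fin n → ℝ := Function.update (fun _ => α) i β
  have he : ∀ k, e k ∈ Icc α β := fun k => by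
    simp only [e, Function.update_apply]; split_ifs <;> assumption
  have hup : ∀ k, Function.update v i u k ∈ Icc α β := fun k => by
    simp only [Function.update_apply]; split_ifs <;> [assumption; exact hv k]
  have hmax : ∀ k, max (e k) (v k) ∈ Icc α β := fun k =>
    ⟨le_max_of_le_left (he k).1, max_le (he k).2 (hv k).2⟩
  have hmin : ∀ k, min (e k) (v k) ∈ Icc α β := fun k =>
    ⟨le_min (he k).1 (hv k).1, min_le_of_left_le (he k).2⟩
  have hmono : shiftInf φ ν (empMeas n id) (Function.update v i u) ≤
      shiftInf φ ν (empMeas n id) (fun k => max (e k) (v k)) := by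
    have := D.shiftInf_le_add (P := empMeas n id) (P' := empMeas n id) (hmeas _) hup
      (h' := fun k => max (e k) (v k)) (c := 0) fun k => by
        rw [add_zero]
        refine integral_mono (D.integrable (hmeas _) hup (D.mem k))
          (D.integrable (hmeas _) hmax (D.mem k)) fun j =>
          D.conj.monotoneOn (sub_mem_Icc_of_mem (hup j) (D.mem k))
            (sub_mem_Icc_of_mem (hmax j) (D.mem k)) (sub_le_sub_right ?_ _)
        by_cases hj : j = i
        · subst hj; simp [e, hu.2]
        · simp [hj]
    simpa using this
  have hcost : α - z + ∫ k, φ (e k - (α - z)) ∂(empMeas n id) - α =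
      -z + ((n : ℝ) - 1) / n * φ z + 1 / n * φ (β - α + z) := by
    rw [integral_empMeas (id : Fin n → Fin n) (g := fun k => φ (e k - (α - z))) (hmeas _),
      ← Finset.add_sum_erase _ _ (Finset.mem_univ i),
      Finset.sum_congr rfl (g := fun _ => φ z) fun k hk => by
        simp [e, Finset.ne_of_mem_erase hk]]
    simp only [id, e, Function.update_self, Finset.sum_const,
      Finset.card_erase_of_mem (Finset.mem_univ i), Finset.card_univ, Fintype.card_fin,
      nsmul_eq_mul]
    rw [Nat.cast_pred hn, show β - (α - z) = β - α + z by ring]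
    have : (n : ℝ) ≠ 0 := by positivity
    field_simp
    ring
  rw [← hcost, ← sub_le_iff_le_add]
  refine le_ciInf fun k => ?_
  have hk := D.mem k
  have hM : max (α - z) (ν k) ∈ Icc (α - p) (β - p) :=
    ⟨le_max_of_le_left hs.1, max_le hs.2 hk.2⟩
  have hm : min (α - z) (ν k) ∈ Icc (α - p) (β - p) :=
    ⟨le_min hs.1 hk.1, min_le_of_left_le hs.2⟩
  have h1 := D.shiftInf_le (P := empMeas n id) (hmeas _) hmax hM
  have h2 := (D.le_shiftInf (P := empMeas n id) (hmeas _) hmin).trans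
    (D.shiftInf_le (P := empMeas n id) (hmeas _) hmin hm)
  have h3 := integral_mono
    ((D.integrable (P := empMeas n id) (hmeas _) hmax hM).add
      (D.integrable (P := empMeas n id) (hmeas _) hmin hm))
    ((D.integrable (P := empMeas n id) (hmeas _) he hs).add
      (D.integrable (P := empMeas n id) (hmeas _) hv hk))
    fun j => D.add_apply_le (he j) (hv j) hs hk
  simp only [Pi.add_apply] at h3
  rw [integral_add (D.integrable (hmeas _) hmax hM) (D.integrable (hmeas _) hmin hm),
    integral_add (D.integrable (hmeas _) he hs) (D.integrable (hmeas _) hv hk)] at h3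
  have h4 := max_add_min (α - z) (ν k)
  linarith

theorem IsShiftData.shiftInf_update_le_Δq {f : ℝ → ℝ} {a : ℝ} {b : EReal}
    (D : IsShiftData (fStarR f a b) ν (zz f) α β M) {n : ℕ} (hn : 0 < n)
    {v : Fin n → ℝ} (hv : ∀ k, v k ∈ Icc α β) (i : Fin n) {u : ℝ} (hu : u ∈ Icc α β) :
    shiftInf (fStarR f a b) ν (empMeas n id) (Function.update v i u) ≤
      shiftInf (fStarR f a b) ν (empMeas n id) v + Δq f a b α β n / n := by
  have hn' : (0 : ℝ) < n := by exact_mod_cast hn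
  rw [← sub_le_iff_le_add', le_div_iff₀ hn', mul_comm]
  refine le_csInf (Nonempty.image _ ⟨zz f, by linarith [D.lt], le_rfl⟩) ?_
  rintro _ ⟨z, hz, rfl⟩
  have := D.shiftInf_update_le hn hv i hu hz
  exact mul_le_mul_of_nonneg_left (by linarith) hn'.le

theorem IsShiftData.abs_shiftInf_empMeas_update_sub_le {f : ℝ → ℝ} {a : ℝ} {b : EReal}
    (D : IsShiftData (fStarR f a b) ν (zz f) α β M) {n : ℕ} (hn : 0 < n)
    {h : X → ℝ} (hm : Measurable h) (hb : ∀ x, h x ∈ Icc α β) (x : Fin n → X) (i : Fin n) (u : X) :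
    |shiftInf (fStarR f a b) ν (empMeas n (Function.update x i u)) h -
      shiftInf (fStarR f a b) ν (empMeas n x) h| ≤ Δq f a b α β n / n := by
  have e1 := D.shiftInf_update_le_Δq hn (fun k => hb (x k)) i (hb u)
  have e2 := D.shiftInf_update_le_Δq hn (fun k => hb (Function.update x i u k)) i (hb (x i))
  have e3 : Function.update (fun k => h (x k)) i (h u) = fun k => h (Function.update x i u k) := by
    ext k; simp only [Function.update_apply]; split_ifs <;> rfl
  have e4 : Function.update (fun k => h (Function.update x i u k)) i (h (x i)) =
      fun k => h (x k) := by
    rw [← e3, Function.update_idem, Function.update_eq_self_iff.2 rfl]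
  rw [e4] at e2
  rw [e3] at e1
  rw [shiftInf_empMeas D.conj.measurable _ hm, shiftInf_empMeas D.conj.measurable _ hm]
  exact abs_sub_le_iff.2 ⟨by linarith, by linarith⟩

end Empirical

section Expectation

theorem radAvg_add_le {ι : Type*} [Nonempty ι] {n : ℕ} {u v : ι → Fin n → ℝ} {C C' : ℝ}
    (hC : 0 ≤ C) (hC' : 0 ≤ C') (hu : ∀ i k, |u i k| ≤ C) (hv : ∀ i k, |v i k| ≤ C') :
    radAvg (fun i k => u i k + v i k) ≤ radAvg u + radAvg v := by
  simp only [radAvg]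
  rw [← mul_add, ← Finset.sum_add_distrib]
  refine mul_le_mul_of_nonneg_left (Finset.sum_le_sum fun σ _ => ?_) (by positivity)
  simp only [mul_add, Finset.sum_add_distrib]
  exact ciSup_add_le_ciSup_add_ciSup
    (bddAbove_of_abs_le fun i => abs_avg_boolSign_le σ hC (hu i))
    (bddAbove_of_abs_le fun i => abs_avg_boolSign_le σ hC' (hv i))

theorem abs_le_of_mem_Icc {u α β : ℝ} (hu : u ∈ Icc α β) : |u| ≤ |α| + |β| := by
  have h1 := neg_abs_le α
  have h2 := le_abs_self β
  have h3 := abs_nonneg α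
  have h4 := abs_nonneg β
  exact abs_le.2 ⟨by linarith [hu.1], by linarith [hu.2]⟩

variable {φ : ℝ → ℝ} {ν : ℕ → ℝ} {p α β M c L : ℝ} {ι : Type*}

namespace IsShiftData

theorem radAvg_le [Nonempty ι] (D : IsShiftData φ ν p α β M) {n : ℕ} (hn : 0 < n)
    {u : ι → Fin n → ℝ}
    (hu : ∀ i k, u i k ∈ Icc α β) (hc : 0 ≤ c) (hL : 0 ≤ L)
    (hφ : ∀ s ∈ Icc (p - (β - α)) (p + (β - α)), ∀ t ∈ Icc (p - (β - α)) (p + (β - α)),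
      |(φ s - c * s) - (φ t - c * t)| ≤ L * |s - t|) :
    radAvg (fun (q : ι × ℕ) k => φ (u q.1 k - ν q.2) + c * ν q.2) ≤
      c * radAvg u + L * (radAvg u + (β - α) / (2 * √n)) := by
  have hlt := D.lt
  have hM := D.conj.nonneg
  have hw : 0 ≤ β - α := by linarith
  have hJ : ∀ (q : ι × ℕ) k, u q.1 k - ν q.2 ∈ Icc (p - (β - α)) (p + (β - α)) := fun q k =>
    sub_mem_Icc_of_mem (hu q.1 k) (D.mem q.2)
  have hA : ∀ i k, |u i k| ≤ |α| + |β| := fun i k => abs_le_of_mem_Icc (hu i k)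
  have hJ' : ∀ z ∈ Icc (p - (β - α)) (p + (β - α)), |z| ≤ |p| + (β - α) := fun z hz => by
    have h1 := neg_abs_le p
    have h2 := le_abs_self p
    exact abs_le.2 ⟨by linarith [hz.1], by linarith [hz.2]⟩
  set C := |p| + (β - α)
  set C' := |p| + M * (β - α) + c * C
  have hC0 : 0 ≤ C := by positivity
  have hC0' : 0 ≤ C' := by positivity
  have hχ : ∀ z ∈ Icc (p - (β - α)) (p + (β - α)), |φ z - c * z| ≤ C' := fun z hz => by
    refine (abs_sub _ _).trans (add_le_add (D.abs_apply_le hz) ?_)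
    rw [abs_mul, abs_of_nonneg hc]
    exact mul_le_mul_of_nonneg_left (hJ' z hz) hc
  have h1 : radAvg (fun (q : ι × ℕ) k => φ (u q.1 k - ν q.2) + c * ν q.2) ≤
      radAvg (fun (q : ι × ℕ) k => c * u q.1 k) +
      radAvg (fun (q : ι × ℕ) k => φ (u q.1 k - ν q.2) - c * (u q.1 k - ν q.2)) := by
    refine Eq.trans_le ?_ (radAvg_add_le (C := c * (|α| + |β|)) (C' := C') (by positivity) hC0'
      (fun q k => ?_) (fun q k => hχ _ (hJ q k)))
    · congr 1
      ext q k
      ring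
    · rw [abs_mul, abs_of_nonneg hc]
      exact mul_le_mul_of_nonneg_left (hA _ _) hc
  have h2 : radAvg (fun (q : ι × ℕ) k => c * u q.1 k) ≤
      c * radAvg (fun (q : ι × ℕ) k => u q.1 k) :=
    radAvg_contraction (C := max (|α| + |β|) (c * (|α| + |β|))) hc
      (fun q k => (hA _ _).trans (le_max_left _ _))
      (fun q k => by
        rw [abs_mul, abs_of_nonneg hc]
        exact (mul_le_mul_of_nonneg_left (hA _ _) hc).trans (le_max_right _ _))
      (fun k q r => by rw [← mul_sub, abs_mul, abs_of_nonneg hc])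
  have h3 : radAvg (fun (q : ι × ℕ) k => u q.1 k) ≤ radAvg u := by
    have := radAvg_sub_le (κ := ℕ) (ν := fun _ => 0) (p := 0) (w := 0) hn (by positivity) hA
      (by simp)
    simpa using this
  have h4 : radAvg (fun (q : ι × ℕ) k => φ (u q.1 k - ν q.2) - c * (u q.1 k - ν q.2)) ≤
      L * radAvg (fun (q : ι × ℕ) k => u q.1 k - ν q.2) :=
    radAvg_contraction (C := max C C') hL
      (fun q k => (hJ' _ (hJ q k)).trans (le_max_left _ _))
      (fun q k => (hχ _ (hJ q k)).trans (le_max_right _ _))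
      (fun k q r => hφ _ (hJ q k) _ (hJ r k))
  have h5 : radAvg (fun (q : ι × ℕ) k => u q.1 k - ν q.2) ≤
      radAvg u + (β - α) / (2 * √n) :=
    radAvg_sub_le (p := (α + β) / 2 - p) hn (by positivity) hA fun j =>
      abs_le.2 ⟨by linarith [(D.mem j).1], by linarith [(D.mem j).2]⟩
  calc _ ≤ _ := h1
    _ ≤ _ := add_le_add (h2.trans (mul_le_mul_of_nonneg_left h3 hc))
      (h4.trans (mul_le_mul_of_nonneg_left h5 hL))

variable {X : Type*} [MeasurableSpace X] {Q : Measure X} [IsProbabilityMeasure Q]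

theorem shiftInf_le_add_iSup (D : IsShiftData φ ν p α β M) {P P' : Measure X}
    [IsProbabilityMeasure P] [IsProbabilityMeasure P'] {h : ι → X → ℝ}
    (hm : ∀ i, Measurable (h i)) (hb : ∀ i x, h i x ∈ Icc α β) (c : ℝ) (i : ι) :
    shiftInf φ ν P (h i) - shiftInf φ ν P' (h i) ≤
      ⨆ q : ι × ℕ, ((∫ x, (φ (h q.1 x - ν q.2) + c * ν q.2) ∂P) -
        ∫ x, (φ (h q.1 x - ν q.2) + c * ν q.2) ∂P') := by
  have hlt := D.lt
  have e : ∀ q : ι × ℕ, (∫ x, (φ (h q.1 x - ν q.2) + c * ν q.2) ∂P) -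
        ∫ x, (φ (h q.1 x - ν q.2) + c * ν q.2) ∂P' =
      (∫ x, φ (h q.1 x - ν q.2) ∂P) - ∫ x, φ (h q.1 x - ν q.2) ∂P' := fun q => by
    rw [integral_add (D.integrable (hm _) (hb _) (D.mem _)) (integrable_const _),
      integral_add (D.integrable (hm _) (hb _) (D.mem _)) (integrable_const _)]
    simp
  simp only [e]
  have hI : ∀ (P₀ : Measure X) [IsProbabilityMeasure P₀] (q : ι × ℕ),
      |(∫ x, φ (h q.1 x - ν q.2) ∂P₀)| ≤ |p| + M * (β - α) := fun _ _ q =>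
    abs_integral_le_of_abs_le fun x => D.abs_apply_le (sub_mem_Icc_of_mem (hb _ x) (D.mem _))
  rw [sub_le_iff_le_add']
  refine D.shiftInf_le_add (hm i) (hb i) fun k => ?_
  rw [← sub_le_iff_le_add']
  exact le_ciSup (f := fun q : ι × ℕ => (∫ x, φ (h q.1 x - ν q.2) ∂P) -
    ∫ x, φ (h q.1 x - ν q.2) ∂P') (bddAbove_of_abs_le fun q =>
      (abs_sub _ _).trans (add_le_add (hI P q) (hI P' q))) (i, k)

theorem measurable_shiftInf_empMeas (D : IsShiftData φ ν p α β M) {n : ℕ} {h : X → ℝ}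
    (hm : Measurable h) : Measurable fun x : Fin n → X => shiftInf φ ν (empMeas n x) h := by
  have hφ := D.conj.measurable
  have : (fun x : Fin n → X => shiftInf φ ν (empMeas n x) h) =
      fun x => ⨅ k, (ν k + (n : ℝ)⁻¹ * ∑ j, φ (h (x j) - ν k)) := by
    ext x
    refine iInf_congr fun k => ?_
    rw [integral_empMeas x (g := fun y => φ (h y - ν k)) (by fun_prop)]
  rw [this]
  exact Measurable.iInf fun k => by fun_prop

theorem abs_shiftInf_sub_shiftInf_le (D : IsShiftData φ ν p α β M) {P P' : Measure X}
    [IsProbabilityMeasure P] [IsProbabilityMeasure P'] {h : X → ℝ}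
    (hm : Measurable h) (hb : ∀ x, h x ∈ Icc α β) :
    |shiftInf φ ν P h - shiftInf φ ν P' h| ≤ β - α := by
  have h1 := D.le_shiftInf (P := P) hm hb
  have h2 := D.le_shiftInf (P := P') hm hb
  have h3 := D.shiftInf_le_right (P := P) hm hb
  have h4 := D.shiftInf_le_right (P := P') hm hb
  exact abs_sub_le_iff.2 ⟨by linarith, by linarith⟩

/-- Expected uniform deviation of `Λ_f` under empirical sampling, both signs. -/
theorem integral_iSup_shiftInf_sub_le [Nonempty ι] [Countable ι]
    (D : IsShiftData φ ν p α β M) {n : ℕ} (hn : 0 < n) {h : ι → X → ℝ} (hm : ∀ i, Measurable (h i))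
    (hb : ∀ i x, h i x ∈ Icc α β) (hc : 0 ≤ c) (hL : 0 ≤ L)
    (hφ : ∀ s ∈ Icc (p - (β - α)) (p + (β - α)), ∀ t ∈ Icc (p - (β - α)) (p + (β - α)),
      |(φ s - c * s) - (φ t - c * t)| ≤ L * |s - t|) :
    (∫ x, ⨆ i, (shiftInf φ ν (empMeas n x) (h i) - shiftInf φ ν Q (h i))
      ∂(Measure.pi fun _ : Fin n => Q)) ≤
      2 * (c * (∫ x, radAvg (fun i k => h i (x k)) ∂(Measure.pi fun _ : Fin n => Q)) +
        L * ((∫ x, radAvg (fun i k => h i (x k)) ∂(Measure.pi fun _ : Fin n => Q)) +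
          (β - α) / (2 * √n))) ∧
    (∫ x, ⨆ i, (shiftInf φ ν Q (h i) - shiftInf φ ν (empMeas n x) (h i))
      ∂(Measure.pi fun _ : Fin n => Q)) ≤
      2 * (c * (∫ x, radAvg (fun i k => h i (x k)) ∂(Measure.pi fun _ : Fin n => Q)) +
        L * ((∫ x, radAvg (fun i k => h i (x k)) ∂(Measure.pi fun _ : Fin n => Q)) +
          (β - α) / (2 * √n))) := by
  set μ := Measure.pi fun _ : Fin n => Q
  have hlt := D.lt
  have hM := D.conj.nonneg
  have hφm := D.conj.measurable
  have hw : 0 ≤ β - α := by linarith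
  have hP := fun x : Fin n → X => isProbabilityMeasure_empMeas hn x
  set g : ι × ℕ → X → ℝ := fun q x => φ (h q.1 x - ν q.2) + c * ν q.2 with hg
  have hgm : ∀ q, Measurable (g q) := fun q => by
    have := hm q.1
    simp only [hg]
    fun_prop
  set C := |p| + M * (β - α) + c * (|α - p| + |β - p|)
  have hC0 : 0 ≤ C := by positivity
  have hgC : ∀ q x, |g q x| ≤ C := fun q x => by
    refine (abs_add_le _ _).trans (add_le_add
      (D.abs_apply_le (sub_mem_Icc_of_mem (hb _ x) (D.mem _))) ?_)
    rw [abs_mul, abs_of_nonneg hc]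
    exact mul_le_mul_of_nonneg_left (abs_le_of_mem_Icc (D.mem _)) hc
  have hrad : Integrable (fun x : Fin n → X => radAvg fun i k => h i (x k)) μ :=
    Integrable.of_bound (measurable_radAvg hm).aestronglyMeasurable (|α| + |β|)
      (ae_of_all _ fun x => abs_radAvg_le (by positivity) fun i k => abs_le_of_mem_Icc (hb _ _))
  set r : (Fin n → X) → ℝ := fun x => radAvg fun i k => h i (x k)
  have hr : Integrable (fun x => c * r x + L * (r x + (β - α) / (2 * √n))) μ :=
    (hrad.const_mul c).add ((hrad.add (integrable_const _)).const_mul L)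
  have hrI : ∫ x, c * r x + L * (r x + (β - α) / (2 * √n)) ∂μ =
      c * (∫ x, r x ∂μ) + L * ((∫ x, r x ∂μ) + (β - α) / (2 * √n)) := by
    have e1 : ∫ x, r x + (β - α) / (2 * √n) ∂μ = (∫ x, r x ∂μ) + (β - α) / (2 * √n) := by
      rw [integral_add hrad (integrable_const _)]
      simp
    rw [← e1, ← integral_const_mul, ← integral_const_mul]
    exact integral_add (hrad.const_mul c) ((hrad.add (integrable_const _)).const_mul L)
  have hR : ∫ x, radAvg (fun q k => g q (x k)) ∂μ ≤
      c * (∫ x, r x ∂μ) + L * ((∫ x, r x ∂μ) + (β - α) / (2 * √n)) := by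
    rw [← hrI]
    have hgr : Integrable (fun x : Fin n → X => radAvg fun q k => g q (x k)) μ :=
      Integrable.of_bound (measurable_radAvg hgm).aestronglyMeasurable C
        (ae_of_all _ fun x => abs_radAvg_le hC0 fun q k => hgC q (x k))
    exact integral_mono hgr hr fun x => D.radAvg_le (u := fun i k => h i (x k)) hn
      (fun i k => hb i (x k)) hc hL hφ
  have hgI : ∀ q, |∫ x, g q x ∂Q| ≤ C := fun q => abs_integral_le_of_abs_le (hgC q)
  have hgA : ∀ q (x : Fin n → X), |(n : ℝ)⁻¹ * ∑ k, g q (x k)| ≤ C := fun q x =>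
    abs_avg_le hC0 fun k => hgC q (x k)
  have hmL := fun i => D.measurable_shiftInf_empMeas (n := n) (hm i)
  have hint : ∀ {ι' : Type _} [Countable ι'] [Nonempty ι'] (F : ι' → (Fin n → X) → ℝ) (B : ℝ),
      (∀ i, Measurable (F i)) → (∀ i x, |F i x| ≤ B) → Integrable (fun x => ⨆ i, F i x) μ :=
    fun F B hF hB => Integrable.of_bound (Measurable.iSup hF).aestronglyMeasurable B
      (ae_of_all _ fun x => abs_ciSup_le fun i => hB i x)
  have havg : ∀ q, Measurable fun x : Fin n → X => (n : ℝ)⁻¹ * ∑ k, g q (x k) := fun q =>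
    (Finset.measurable_sum _ fun k _ => (hgm q).comp (measurable_pi_apply k)).const_mul _
  constructor
  · refine le_trans (integral_mono
      (hint _ (β - α) (fun i => (hmL i).sub_const _)
        fun i x => D.abs_shiftInf_sub_shiftInf_le (hm i) (hb i))
      (hint (fun q x => (n : ℝ)⁻¹ * ∑ k, g q (x k) - ∫ z, g q z ∂Q) (C + C)
        (fun q => (havg q).sub_const _)
        fun q x => (abs_sub _ _).trans (add_le_add (hgA q x) (hgI q))) fun x => ?_)
      ((integral_ciSup_avg_sub_integral_le Q hn hgm hgC).trans
        (mul_le_mul_of_nonneg_left hR zero_le_two))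
    refine ciSup_le fun i => ?_
    have := D.shiftInf_le_add_iSup (P := empMeas n x) (P' := Q) hm hb c i
    have e : ∀ q, ∫ y, g q y ∂(empMeas n x) = (n : ℝ)⁻¹ * ∑ k, g q (x k) := fun q =>
      integral_empMeas x (hgm q)
    simp only [← e]
    exact this
  · refine le_trans (integral_mono
      (hint _ (β - α) (fun i => (hmL i).const_sub _)
        fun i x => D.abs_shiftInf_sub_shiftInf_le (hm i) (hb i))
      (hint (fun q x => (∫ z, g q z ∂Q) - (n : ℝ)⁻¹ * ∑ k, g q (x k)) (C + C)
        (fun q => (havg q).const_sub _)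
        fun q x => (abs_sub _ _).trans (add_le_add (hgI q) (hgA q x))) fun x => ?_)
      ((integral_ciSup_integral_sub_avg_le Q hn hgm hgC).trans
        (mul_le_mul_of_nonneg_left hR zero_le_two))
    refine ciSup_le fun i => ?_
    have := D.shiftInf_le_add_iSup (P := Q) (P' := empMeas n x) hm hb c i
    have e : ∀ q, ∫ y, g q y ∂(empMeas n x) = (n : ℝ)⁻¹ * ∑ k, g q (x k) := fun q =>
      integral_empMeas x (hgm q)
    simp only [← e]
    exact this

end IsShiftData

end Expectation

section SequentialDensity

/-- The family `g` lies in `Ψ`, and `Ψ` is contained in the closure of `g` under pointwise limits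
of sequences. -/
structure IsSeqDenseIn {ι Y : Type*} (g : ι → Y → ℝ) (Ψ : Set (Y → ℝ)) : Prop where
  mem : ∀ i, g i ∈ Ψ
  subset : ∀ S : Set (Y → ℝ), IsSeqClosed S → (∀ i, g i ∈ S) → Ψ ⊆ S

theorem PtwiseDenseCount.exists_isSeqDenseIn {X : Type*} {Γ : Set (X → ℝ)}
    (h : PtwiseDenseCount Γ) (hne : Γ.Nonempty) : ∃ g : ℕ → X → ℝ, IsSeqDenseIn g Γ := by
  obtain ⟨Γ₀, hsub, hc, hd⟩ := h
  have hne₀ : Γ₀.Nonempty := by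
    obtain ⟨h, hh⟩ := hne
    obtain ⟨s, hs, -⟩ := hd h hh
    exact ⟨s 0, hs 0⟩
  obtain ⟨g, rfl⟩ := hc.exists_eq_range hne₀
  refine ⟨g, fun i => hsub ⟨i, rfl⟩, fun S hS hg h hh => ?_⟩
  obtain ⟨s, hs, hlim⟩ := hd h hh
  refine hS (x := s) (fun j => ?_) (tendsto_pi_nhds.2 hlim)
  obtain ⟨i, hi⟩ := hs j
  exact hi ▸ hg i

theorem IsSeqDenseIn.comp {ι X Z Θ : Type*} [TopologicalSpace X] [MetricSpace Θ]
    [TopologicalSpace.SeparableSpace Θ] [Nonempty Θ] {g : ι → X → ℝ} {Γ : Set (X → ℝ)}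
    (hg : IsSeqDenseIn g Γ) (hcont : ∀ h ∈ Γ, Continuous h) {Φ : Θ → Z → X}
    (hΦ : ∀ z, Continuous fun θ => Φ θ z) :
    IsSeqDenseIn (fun (q : ι × ℕ) z => g q.1 (Φ (TopologicalSpace.denseSeq Θ q.2) z))
      {ψ : Z → ℝ | ∃ h ∈ Γ, ∃ θ : Θ, ψ = fun z => h (Φ θ z)} := by
  refine ⟨fun q => ⟨_, hg.mem q.1, _, rfl⟩, fun S hS hgS => ?_⟩
  have h1 : ∀ i θ, (fun z => g i (Φ θ z)) ∈ S := by
    intro i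
    have hcl : IsClosed {θ | (fun z => g i (Φ θ z)) ∈ S} :=
      IsSeqClosed.isClosed fun t θ ht hlim => hS ht <| tendsto_pi_nhds.2 fun z =>
        (((hcont _ (hg.mem i)).comp (hΦ z)).tendsto θ).comp hlim
    have := hcl.closure_subset_iff.2 (range_subset_iff.2 fun k => hgS (i, k))
    rw [(TopologicalSpace.denseRange_denseSeq Θ).closure_range] at this
    exact fun θ => this (mem_univ θ)
  rintro _ ⟨h, hh, θ, rfl⟩
  refine hg.subset {h | (fun z => h (Φ θ z)) ∈ S} (fun s h hs hlim => hS hs ?_)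
    (fun i => h1 i θ) hh
  exact tendsto_pi_nhds.2 fun z => (tendsto_pi_nhds.1 hlim) (Φ θ z)

variable {Y ι : Type*} [MeasurableSpace Y] {g : ι → Y → ℝ} {Ψ : Set (Y → ℝ)} {α β : ℝ}

/-- Continuity of a functional along pointwise convergent sequences of measurable functions with
values in `[α, β]`. -/
def IsBoundedSeqCont (α β : ℝ) (T : (Y → ℝ) → ℝ) : Prop :=
  ∀ (s : ℕ → Y → ℝ) (ψ : Y → ℝ), (∀ j, Measurable (s j)) → (∀ j y, s j y ∈ Icc α β) →
    Measurable ψ → (∀ y, ψ y ∈ Icc α β) → (∀ y, Tendsto (fun j => s j y) atTop (𝓝 (ψ y))) →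
    Tendsto (fun j => T (s j)) atTop (𝓝 (T ψ))

theorem IsSeqDenseIn.measurable_and_le (hg : IsSeqDenseIn g Ψ) (hm : ∀ i, Measurable (g i))
    (hb : ∀ i y, g i y ∈ Icc α β) {T : (Y → ℝ) → ℝ} (hT : IsBoundedSeqCont α β T) {B : ℝ}
    (hB : ∀ i, T (g i) ≤ B) {ψ : Y → ℝ} (hψ : ψ ∈ Ψ) :
    Measurable ψ ∧ (∀ y, ψ y ∈ Icc α β) ∧ T ψ ≤ B := by
  refine hg.subset {ψ | Measurable ψ ∧ (∀ y, ψ y ∈ Icc α β) ∧ T ψ ≤ B} ?_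
    (fun i => ⟨hm i, hb i, hB i⟩) hψ
  intro s ψ hs hlim
  have hlim' := tendsto_pi_nhds.1 hlim
  have h1 : Measurable ψ := measurable_of_tendsto_metrizable (fun j => (hs j).1) hlim
  have h2 : ∀ y, ψ y ∈ Icc α β := fun y =>
    isClosed_Icc.mem_of_tendsto (hlim' y) (Eventually.of_forall fun j => (hs j).2.1 y)
  exact ⟨h1, h2, le_of_tendsto' (hT s ψ (fun j => (hs j).1) (fun j => (hs j).2.1) h1 h2 hlim')
    fun j => (hs j).2.2⟩

theorem IsSeqDenseIn.le_of_forall (hg : IsSeqDenseIn g Ψ) (hm : ∀ i, Measurable (g i))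
    (hb : ∀ i y, g i y ∈ Icc α β) {T : (Y → ℝ) → ℝ} (hT : IsBoundedSeqCont α β T) {B : ℝ}
    (hB : ∀ i, T (g i) ≤ B) {ψ : Y → ℝ} (hψ : ψ ∈ Ψ) : T ψ ≤ B :=
  (hg.measurable_and_le hm hb hT hB hψ).2.2

theorem IsBoundedSeqCont.sub {T T' : (Y → ℝ) → ℝ} (hT : IsBoundedSeqCont α β T)
    (hT' : IsBoundedSeqCont α β T') : IsBoundedSeqCont α β fun ψ => T ψ - T' ψ :=
  fun s ψ h1 h2 h3 h4 h5 => (hT s ψ h1 h2 h3 h4 h5).sub (hT' s ψ h1 h2 h3 h4 h5)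

theorem isBoundedSeqCont_integral (P : Measure Y) [IsProbabilityMeasure P] :
    IsBoundedSeqCont α β fun ψ => ∫ y, ψ y ∂P := fun _ _ hs hsb _ _ hlim =>
  tendsto_integral_of_dominated_convergence (fun _ => |α| + |β|)
    (fun j => (hs j).aestronglyMeasurable) (integrable_const _)
    (fun j => ae_of_all _ fun y => abs_le_of_mem_Icc (hsb j y)) (ae_of_all _ hlim)

theorem isBoundedSeqCont_avg {n : ℕ} (c : Fin n → ℝ) (y : Fin n → Y) :
    IsBoundedSeqCont α β fun ψ => (n : ℝ)⁻¹ * ∑ k, c k * ψ (y k) := fun _ _ _ _ _ _ hlim =>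
  (tendsto_finsetSum _ fun k _ => (hlim (y k)).const_mul (c k)).const_mul _

theorem IsShiftData.isBoundedSeqCont {φ : ℝ → ℝ} {ν : ℕ → ℝ} {p M : ℝ}
    (D : IsShiftData φ ν p α β M) (P : Measure Y) [IsProbabilityMeasure P] :
    IsBoundedSeqCont α β fun ψ => shiftInf φ ν P ψ := by
  intro s ψ hs hsb hψ hψb hlim
  have h0 : Tendsto (fun j => M * ∫ y, |s j y - ψ y| ∂P) atTop (𝓝 0) := by
    have := tendsto_integral_of_dominated_convergence (μ := P) (F := fun j y => |s j y - ψ y|)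
      (f := fun _ => (0 : ℝ)) (fun _ => β - α)
      (fun j => ((hs j).sub hψ).abs.aestronglyMeasurable) (integrable_const _)
      (fun j => ae_of_all _ fun y => by
        rw [Real.norm_eq_abs, abs_abs]
        exact abs_le.2 ⟨by linarith [(hsb j y).1, (hψb y).2], by linarith [(hsb j y).2, (hψb y).1]⟩)
      (ae_of_all _ fun y => by simpa using ((hlim y).sub_const (ψ y)).abs)
    simpa using this.const_mul M
  refine tendsto_iff_dist_tendsto_zero.2 (squeeze_zero (fun _ => dist_nonneg) (fun j => ?_) h0)
  exact D.abs_shiftInf_sub_le (hs j) (hsb j) hψ hψb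

theorem IsSeqDenseIn.empRad_eq [Nonempty ι] (hg : IsSeqDenseIn g Ψ) (hm : ∀ i, Measurable (g i))
    (hb : ∀ i y, g i y ∈ Icc α β) {n : ℕ} (y : Fin n → Y) :
    empRad Ψ n y = radAvg fun i k => g i (y k) := by
  rw [empRad, radAvg]
  congr 1
  refine Finset.sum_congr rfl fun σ _ => ?_
  have hσ : ∀ ψ : Y → ℝ, ∑ k, (if σ k then 1 else -1) * ψ (y k) =
      ∑ k, boolSign (σ k) * ψ (y k) := fun ψ => by simp [boolSign]
  simp only [hσ]
  have hbd : BddAbove (range fun i => (n : ℝ)⁻¹ * ∑ k, boolSign (σ k) * g i (y k)) :=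
    bddAbove_of_abs_le (C := |α| + |β|) fun i =>
      abs_avg_boolSign_le σ (by positivity) fun k => abs_le_of_mem_Icc (hb i (y k))
  have hle : ∀ ψ ∈ Ψ, (n : ℝ)⁻¹ * ∑ k, boolSign (σ k) * ψ (y k) ≤
      ⨆ i, (n : ℝ)⁻¹ * ∑ k, boolSign (σ k) * g i (y k) := fun ψ hψ =>
    hg.le_of_forall (α := α) (β := β) hm hb (isBoundedSeqCont_avg _ y) (fun i => le_ciSup hbd i) hψ
  refine le_antisymm (csSup_le ?_ ?_) (ciSup_le fun i => le_csSup ?_ ⟨g i, hg.mem i, rfl⟩)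
  · exact ⟨_, g (Classical.arbitrary ι), hg.mem _, rfl⟩
  · rintro _ ⟨ψ, hψ, rfl⟩
    exact hle ψ hψ
  · refine ⟨⨆ i, (n : ℝ)⁻¹ * ∑ k, boolSign (σ k) * g i (y k), ?_⟩
    rintro _ ⟨ψ, hψ, rfl⟩
    exact hle ψ hψ

theorem IsSeqDenseIn.rad_eq [Nonempty ι] (hg : IsSeqDenseIn g Ψ) (hm : ∀ i, Measurable (g i))
    (hb : ∀ i y, g i y ∈ Icc α β) (P : Measure Y) (n : ℕ) :
    rad Ψ P n = ∫ y, radAvg (fun i k => g i (y k)) ∂(Measure.pi fun _ : Fin n => P) :=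
  integral_congr_ae (ae_of_all _ fun y => hg.empRad_eq hm hb y)

end SequentialDensity

section Divergence

variable {X : Type*} [MeasurableSpace X] {f : ℝ → ℝ} {a : ℝ} {b : EReal} {ν : ℕ → ℝ} {α β M : ℝ}
  {Γ Γt : Set (X → ℝ)} {P Q : Measure X}

theorem Dfg_le (hne : Γ.Nonempty) {B : ℝ}
    (hB : ∀ h ∈ Γ, (∫ x, h x ∂P) - cgfR f a b Q h ≤ B) : Dfg f a b Γ P Q ≤ B := by
  obtain ⟨h, hh⟩ := hne
  refine csSup_le ⟨_, h, hh, rfl⟩ ?_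
  rintro _ ⟨k, hk, rfl⟩
  exact hB k hk

variable [IsProbabilityMeasure P] [IsProbabilityMeasure Q]

namespace IsGenerator

theorem abs_integral_sub_cgfR_le (hf : IsGenerator f a b (β - α))
    (D : IsShiftData (fStarR f a b) ν (zz f) α β M) {h : X → ℝ} (hm : Measurable h)
    (hb : ∀ x, h x ∈ Icc α β) : |(∫ x, h x ∂P) - cgfR f a b Q h| ≤ β - α := by
  rw [hf.cgfR_eq D hm hb]
  have h1 := D.le_shiftInf (P := Q) hm hb
  have h2 := D.shiftInf_le_right (P := Q) hm hb
  have h3 := IsShiftData.le_integral (P := P) hm hb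
  have h4 := IsShiftData.integral_le_right (P := P) hm hb
  exact abs_le.2 ⟨by linarith, by linarith⟩

theorem le_Dfg (hf : IsGenerator f a b (β - α))
    (D : IsShiftData (fStarR f a b) ν (zz f) α β M) (hm : ∀ h ∈ Γ, Measurable h)
    (hb : ∀ h ∈ Γ, ∀ x, h x ∈ Icc α β) {h : X → ℝ} (hh : h ∈ Γ) :
    (∫ x, h x ∂P) - cgfR f a b Q h ≤ Dfg f a b Γ P Q := by
  refine le_csSup ⟨β - α, ?_⟩ ⟨h, hh, rfl⟩
  rintro _ ⟨k, hk, rfl⟩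
  exact (abs_le.1 (hf.abs_integral_sub_cgfR_le D (hm k hk) (hb k hk))).2

theorem le_Dfg' (hf : IsGenerator f a b (β - α))
    (D : IsShiftData (fStarR f a b) ν (zz f) α β M) (hm : ∀ h ∈ Γ, Measurable h)
    (hb : ∀ h ∈ Γ, ∀ x, h x ∈ Icc α β) (hne : Γ.Nonempty) : -(β - α) ≤ Dfg f a b Γ P Q := by
  obtain ⟨h, hh⟩ := hne
  exact (abs_le.1 (hf.abs_integral_sub_cgfR_le D (hm h hh) (hb h hh))).1.trans
    (hf.le_Dfg D hm hb hh)

/-- Replacing `Γ` by a subset `Γt` costs at most the approximation error. -/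
theorem Dfg_le_add_approxErr (hf : IsGenerator f a b (β - α))
    (D : IsShiftData (fStarR f a b) ν (zz f) α β M) (hsub : Γt ⊆ Γ) (hne : Γt.Nonempty)
    (hm : ∀ h ∈ Γ, Measurable h) (hb : ∀ h ∈ Γ, ∀ x, h x ∈ Icc α β) :
    Dfg f a b Γ P Q ≤ Dfg f a b Γt P Q + (1 + M) * approxErr Γ Γt := by
  have hM := D.conj.nonneg
  have hlt := D.lt
  have : Nonempty X := nonempty_of_isProbabilityMeasure P
  have hdist : ∀ h ∈ Γ, ∀ k ∈ Γ, ∀ x, |h x - k x| ≤ β - α := fun h hh k hk x =>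
    abs_le.2 ⟨by linarith [(hb h hh x).1, (hb k hk x).2],
      by linarith [(hb h hh x).2, (hb k hk x).1]⟩
  have hsup : ∀ h ∈ Γ, ∀ k ∈ Γ, BddAbove (range fun x => |h x - k x|) := fun h hh k hk =>
    ⟨β - α, by rintro _ ⟨x, rfl⟩; exact hdist h hh k hk x⟩
  have h0 : ∀ h : X → ℝ, (0 : ℝ) ∈ lowerBounds {s : ℝ | ∃ ht ∈ Γt, s = ⨆ x, |h x - ht x|} := by
    rintro h _ ⟨k, -, rfl⟩
    exact Real.iSup_nonneg fun x => abs_nonneg _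
  refine Dfg_le (hne.mono hsub) fun h hh => ?_
  rw [← sub_le_iff_le_add', ← div_le_iff₀' (by positivity)]
  have hle : ((∫ x, h x ∂P) - cgfR f a b Q h - Dfg f a b Γt P Q) / (1 + M) ≤
      sInf {s : ℝ | ∃ ht ∈ Γt, s = ⨆ x, |h x - ht x|} := by
    obtain ⟨k₀, hk₀⟩ := hne
    refine le_csInf ⟨_, k₀, hk₀, rfl⟩ ?_
    rintro _ ⟨k, hk, rfl⟩
    have hkΓ := hsub hk
    rw [div_le_iff₀' (by positivity)]
    have h1 : (∫ x, k x ∂P) - cgfR f a b Q k ≤ Dfg f a b Γt P Q :=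
      hf.le_Dfg D (fun h hh => hm h (hsub hh)) (fun h hh => hb h (hsub hh)) hk
    have h2 : ∀ (P₀ : Measure X) [IsProbabilityMeasure P₀],
        ∫ x, |h x - k x| ∂P₀ ≤ ⨆ x, |h x - k x| := fun P₀ _ => by
      have := integral_mono (μ := P₀) ((integrable_of_mem_Icc (hm h hh) (hb h hh)).sub
        (integrable_of_mem_Icc (hm k hkΓ) (hb k hkΓ))).abs (integrable_const (⨆ x, |h x - k x|))
        fun x => le_ciSup (hsup h hh k hkΓ) x
      simpa using this
    have h3 : (∫ x, h x ∂P) - ∫ x, k x ∂P ≤ ⨆ x, |h x - k x| := by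
      rw [← integral_sub (integrable_of_mem_Icc (hm h hh) (hb h hh))
        (integrable_of_mem_Icc (hm k hkΓ) (hb k hkΓ))]
      exact (le_abs_self _).trans (abs_integral_le_integral_abs.trans (h2 P))
    have h4 := (abs_le.1 (D.abs_shiftInf_sub_le (P := Q) (hm h hh) (hb h hh) (hm k hkΓ)
      (hb k hkΓ))).1
    rw [← hf.cgfR_eq D (hm h hh) (hb h hh), ← hf.cgfR_eq D (hm k hkΓ) (hb k hkΓ)] at h4
    have h5 := mul_le_mul_of_nonneg_left (h2 Q) hM
    linarith
  refine hle.trans (le_csSup ⟨β - α, ?_⟩ ⟨h, hh, rfl⟩)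
  rintro _ ⟨h, hh, rfl⟩
  obtain ⟨k, hk⟩ := hne
  exact (csInf_le ⟨0, h0 h⟩ ⟨k, hk, rfl⟩).trans (ciSup_le (hdist h hh k (hsub hk)))

/-- Error decomposition for approximate minimizers of a perturbed divergence. -/
theorem Dfg_sub_iInf_le {Θ : Type*} [Nonempty Θ] (hf : IsGenerator f a b (β - α))
    (D : IsShiftData (fStarR f a b) ν (zz f) α β M) (hsub : Γt ⊆ Γ) (hne : Γt.Nonempty)
    (hm : ∀ h ∈ Γ, Measurable h) (hb : ∀ h ∈ Γ, ∀ x, h x ∈ Icc α β)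
    {P P' : Θ → Measure X} [∀ θ, IsProbabilityMeasure (P θ)] [∀ θ, IsProbabilityMeasure (P' θ)]
    {Q Q' : Measure X} [IsProbabilityMeasure Q] [IsProbabilityMeasure Q'] {A A' B B' δ : ℝ}
    (hA : ∀ h ∈ Γt, ∀ θ, (∫ x, h x ∂(P θ)) - ∫ x, h x ∂(P' θ) ≤ A)
    (hA' : ∀ h ∈ Γt, ∀ θ, (∫ x, h x ∂(P' θ)) - ∫ x, h x ∂(P θ) ≤ A')
    (hB : ∀ h ∈ Γt, cgfR f a b Q' h - cgfR f a b Q h ≤ B)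
    (hB' : ∀ h ∈ Γt, cgfR f a b Q h - cgfR f a b Q' h ≤ B') {θ₀ : Θ}
    (hopt : Dfg f a b Γt (P' θ₀) Q' ≤ (⨅ θ, Dfg f a b Γt (P' θ) Q') + δ) :
    Dfg f a b Γ (P θ₀) Q - (⨅ θ, Dfg f a b Γ (P θ) Q) ≤
      (1 + M) * approxErr Γ Γt + δ + (A + A' + (B + B')) := by
  have hmt := fun h hh => hm h (hsub hh)
  have hbt := fun h hh => hb h (hsub hh)
  have h1 := hf.Dfg_le_add_approxErr (P := P θ₀) (Q := Q) D hsub hne hm hb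
  have h2 : Dfg f a b Γt (P θ₀) Q ≤ Dfg f a b Γt (P' θ₀) Q' + (A + B) :=
    Dfg_le hne fun h hh => by
      have := hf.le_Dfg (P := P' θ₀) (Q := Q') D hmt hbt hh
      linarith [hA h hh θ₀, hB h hh]
  have h3 : (⨅ θ, Dfg f a b Γt (P' θ) Q') - (A' + B') ≤ ⨅ θ, Dfg f a b Γ (P θ) Q := by
    refine le_ciInf fun θ => ?_
    rw [sub_le_iff_le_add]
    refine (ciInf_le ⟨-(β - α), ?_⟩ θ).trans (Dfg_le hne fun h hh => ?_)
    · rintro _ ⟨θ, rfl⟩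
      exact hf.le_Dfg' D hmt hbt hne
    · have := hf.le_Dfg (P := P θ) (Q := Q) D hm hb (hsub hh)
      linarith [hA' h hh θ, hB' h hh]
  linarith

end IsGenerator

end Divergence

section Concentration

/-- The sum of the two one-sided uniform deviations of a family `T`. -/
noncomputable def supDev {ι E : Type*} (T : ι → E → ℝ) (e : E) : ℝ :=
  (⨆ i, T i e) + ⨆ i, -T i e

section SupDev

variable {ι E : Type*} {T : ι → E → ℝ} {w : ℝ}

theorem measurable_iSup_and_neg [Countable ι] [MeasurableSpace E] (hT : ∀ i, Measurable (T i)) :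
    (Measurable fun e => ⨆ i, T i e) ∧ Measurable fun e => ⨆ i, -T i e :=
  ⟨Measurable.iSup hT, Measurable.iSup fun i => (hT i).neg⟩

theorem measurable_supDev [Countable ι] [MeasurableSpace E] (hT : ∀ i, Measurable (T i)) :
    Measurable (supDev T) :=
  (measurable_iSup_and_neg hT).1.add (measurable_iSup_and_neg hT).2

variable [Nonempty ι]

theorem abs_supDev_le (hw : ∀ i e, |T i e| ≤ w) (e : E) : |supDev T e| ≤ w + w :=
  (abs_add_le _ _).trans (add_le_add (abs_ciSup_le fun i => hw i e)
    (abs_ciSup_le fun i => by rw [abs_neg]; exact hw i e))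

theorem abs_supDev_sub_le (hw : ∀ i e, |T i e| ≤ w) {c : ℝ} {e e' : E}
    (hc : ∀ i, |T i e - T i e'| ≤ c) : |supDev T e - supDev T e'| ≤ c + c := by
  have hw' : ∀ i e, |-T i e| ≤ w := fun i e => by rw [abs_neg]; exact hw i e
  rw [supDev, supDev, add_sub_add_comm]
  refine (abs_add_le _ _).trans (add_le_add
    (abs_ciSup_sub_ciSup_le (bddAbove_of_abs_le fun i => hw i e)
      (bddAbove_of_abs_le fun i => hw i e') hc)
    (abs_ciSup_sub_ciSup_le (bddAbove_of_abs_le fun i => hw' i e)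
      (bddAbove_of_abs_le fun i => hw' i e') fun i => ?_))
  rw [neg_sub_neg, abs_sub_comm]
  exact hc i

theorem integral_supDev [Countable ι] [MeasurableSpace E] {μ : Measure E} [IsProbabilityMeasure μ]
    (hT : ∀ i, Measurable (T i)) (hw : ∀ i e, |T i e| ≤ w) :
    ∫ e, supDev T e ∂μ = (∫ e, ⨆ i, T i e ∂μ) + ∫ e, ⨆ i, -T i e ∂μ :=
  integral_add
    (Integrable.of_bound (measurable_iSup_and_neg hT).1.aestronglyMeasurable w
      (ae_of_all _ fun e => abs_ciSup_le fun i => hw i e))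
    (Integrable.of_bound (measurable_iSup_and_neg hT).2.aestronglyMeasurable w
      (ae_of_all _ fun e => abs_ciSup_le fun i => by rw [abs_neg]; exact hw i e))

end SupDev

variable {α β : ℝ}

theorem abs_avg_update_sub_le {Y : Type*} {n : ℕ} {g : Y → ℝ} (hb : ∀ y, g y ∈ Icc α β)
    (y : Fin n → Y) (i : Fin n) (u : Y) :
    |(n : ℝ)⁻¹ * ∑ k, g (Function.update y i u k) - (n : ℝ)⁻¹ * ∑ k, g (y k)| ≤ (β - α) / n := by
  have h : ∑ k, g (Function.update y i u k) - ∑ k, g (y k) = g u - g (y i) := by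
    rw [← Finset.sum_sub_distrib, Finset.sum_eq_single i]
    · simp
    · intro k _ hk
      simp [hk]
    · simp
  rw [← mul_sub, h, abs_mul, abs_of_nonneg (by positivity), inv_mul_eq_div]
  gcongr
  exact abs_le.2 ⟨by linarith [(hb u).1, (hb (y i)).2], by linarith [(hb u).2, (hb (y i)).1]⟩

variable {Y : Type*} [MeasurableSpace Y]

theorem measurable_avg_sub_integral {g : Y → ℝ} (hm : Measurable g) (P : Measure Y) {n : ℕ} :
    Measurable fun y : Fin n → Y => (n : ℝ)⁻¹ * ∑ k, g (y k) - ∫ z, g z ∂P :=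
  (((Finset.univ : Finset (Fin n)).measurable_fun_sum fun k _ =>
    hm.comp (measurable_pi_apply k)).const_mul _).sub_const _

theorem abs_avg_sub_integral_le {g : Y → ℝ} {C : ℝ} (hC : ∀ y, |g y| ≤ C) (P : Measure Y)
    [IsProbabilityMeasure P] {n : ℕ} (y : Fin n → Y) :
    |(n : ℝ)⁻¹ * ∑ k, g (y k) - ∫ z, g z ∂P| ≤ C + C := by
  obtain ⟨z⟩ := P.nonempty_of_neZero
  exact (abs_sub _ _).trans (add_le_add (abs_avg_le ((abs_nonneg _).trans (hC z))
    fun k => hC (y k)) (abs_integral_le_of_abs_le hC))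

theorem IsSeqDenseIn.integral_supDev_avg_le {ι : Type*} [Nonempty ι] [Countable ι]
    {g : ι → Y → ℝ} {Ψ : Set (Y → ℝ)} (hg : IsSeqDenseIn g Ψ) (hm : ∀ i, Measurable (g i))
    (hb : ∀ i y, g i y ∈ Icc α β) (P : Measure Y) [IsProbabilityMeasure P] {n : ℕ} (hn : 0 < n) :
    ∫ y, supDev (fun i (y : Fin n → Y) => (n : ℝ)⁻¹ * ∑ k, g i (y k) - ∫ z, g i z ∂P) y
      ∂(Measure.pi fun _ : Fin n => P) ≤ 4 * rad Ψ P n := by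
  have hC : ∀ i y, |g i y| ≤ |α| + |β| := fun i y => abs_le_of_mem_Icc (hb i y)
  have h1 := integral_ciSup_avg_sub_integral_le P hn hm hC
  have h2 := integral_ciSup_integral_sub_avg_le P hn hm hC
  have hT := fun i => measurable_avg_sub_integral (hm i) P (n := n)
  have hw := fun i (y : Fin n → Y) => abs_avg_sub_integral_le (hC i) P y
  rw [integral_supDev hT hw, hg.rad_eq hm hb]
  simp only [neg_sub]
  linarith

theorem IsGenerator.integral_supDev_shiftInf_le {ι : Type*} [Nonempty ι] [Countable ι]
    {f : ℝ → ℝ} {a : ℝ} {b : EReal} {ν : ℕ → ℝ} (hf : IsGenerator f a b (β - α))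
    (D : IsShiftData (fStarR f a b) ν (zz f) α β (rderiv (fStarR f a b) (zz f + (β - α))))
    {g : ι → Y → ℝ} {Ψ : Set (Y → ℝ)} (hg : IsSeqDenseIn g Ψ) (hm : ∀ i, Measurable (g i))
    (hb : ∀ i y, g i y ∈ Icc α β) (Q : Measure Y) [IsProbabilityMeasure Q] {n : ℕ} (hn : 0 < n)
    {K : ℝ} (hK : Kchoice f a b α β Ψ Q n K) :
    ∫ y, supDev (fun i (y : Fin n → Y) => shiftInf (fStarR f a b) ν (empMeas n y) (g i) -
      shiftInf (fStarR f a b) ν Q (g i)) y ∂(Measure.pi fun _ : Fin n => Q) ≤ 4 * K := by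
  have hlt := D.lt
  have hw : 0 ≤ β - α := by linarith
  have hP := fun y : Fin n → Y => isProbabilityMeasure_empMeas hn y
  have hT := fun i => (D.measurable_shiftInf_empMeas (n := n) (hm i)).sub_const
    (shiftInf (fStarR f a b) ν Q (g i))
  have hwT := fun i (y : Fin n → Y) =>
    D.abs_shiftInf_sub_shiftInf_le (P := empMeas n y) (P' := Q) (hm i) (hb i)
  rw [integral_supDev hT hwT]
  simp only [neg_sub]
  have hM := D.integral_iSup_shiftInf_sub_le (Q := Q) (c := 0) hn hm hb le_rfl D.conj.nonneg
    (fun s hs t ht => by simpa using D.conj.lipschitz s hs t ht)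
  rw [← hg.rad_eq hm hb, zero_mul, zero_add, add_comm (zz f)] at hM
  rcases hK with ⟨L, hL, -, rfl⟩ | rfl
  swap
  · linarith [hM.1, hM.2]
  have hLw : 0 ≤ (L : ℝ) * (β - α) := by positivity
  have h1 := D.integral_iSup_shiftInf_sub_le (Q := Q) (c := 1) hn hm hb zero_le_one hLw
    (fun s hs t ht => hf.abs_sub_le (fun z hz => hf.abs_rderiv_sub_one_le hL hz) hs ht)
  have hR : 0 ≤ rad Ψ Q n := by
    rw [hg.rad_eq hm hb]
    exact integral_nonneg fun y => radAvg_nonneg (C := |α| + |β|) (by positivity)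
      fun i k => abs_le_of_mem_Icc (hb i (y k))
  rw [← hg.rad_eq hm hb] at h1
  have h2 : 1 * rad Ψ Q n + L * (β - α) * (rad Ψ Q n + (β - α) / (2 * √n)) ≤
      (1 + 2 * (β - α) * L) * rad Ψ Q n + (β - α) ^ 2 * L / (2 * √n) := by
    have := mul_nonneg hLw hR
    calc _ = (1 + (β - α) * L) * rad Ψ Q n + (β - α) ^ 2 * L / (2 * √n) := by ring
      _ ≤ _ := by linarith
  rw [mul_min_of_nonneg _ _ (by norm_num : (0 : ℝ) ≤ 4)]
  exact le_min (by linarith [h1.1, h1.2]) (by linarith [hM.1, hM.2])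

end Concentration

section Assembly

theorem IsGenerator.exists_isShiftData {f : ℝ → ℝ} {a : ℝ} {b : EReal} {α β : ℝ}
    (hf : IsGenerator f a b (β - α)) : ∃ ν : ℕ → ℝ, IsShiftData (fStarR f a b) ν (zz f) α β
      (rderiv (fStarR f a b) (zz f + (β - α))) := by
  have hlt := sub_pos.1 hf.pos
  have : Nonempty (Icc (α - zz f) (β - zz f)) := ⟨α - zz f, le_rfl, by linarith⟩
  refine ⟨fun k => TopologicalSpace.denseSeq (Icc (α - zz f) (β - zz f)) k, hf.isConjOn,
    fun k => Subtype.coe_prop _, fun s hs => ?_, hlt⟩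
  have hd := TopologicalSpace.denseRange_denseSeq (Icc (α - zz f) (β - zz f))
  have := image_closure_subset_closure_image continuous_subtype_val
    (mem_image_of_mem _ (hd ⟨s, hs⟩))
  rwa [← range_comp] at this

theorem IsSeqDenseIn.apply_le_ciSup {ι Y : Type*} [Nonempty ι] [MeasurableSpace Y]
    {g : ι → Y → ℝ} {Ψ : Set (Y → ℝ)} {α β : ℝ} (hg : IsSeqDenseIn g Ψ)
    (hm : ∀ i, Measurable (g i)) (hb : ∀ i y, g i y ∈ Icc α β) {T : (Y → ℝ) → ℝ}
    (hT : IsBoundedSeqCont α β T) {C : ℝ} (hC : ∀ i, |T (g i)| ≤ C) {ψ : Y → ℝ} (hψ : ψ ∈ Ψ) :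
    T ψ ≤ ⨆ i, T (g i) :=
  hg.le_of_forall hm hb hT (fun i => le_ciSup (bddAbove_of_abs_le hC) i) hψ

/-- Bounded differences inequality for the sum of the uniform deviations of two families, each
depending on its own sample. -/
theorem measure_supDev_add_supDev_ge_le {A B ι κ : Type*} [MeasurableSpace A] [MeasurableSpace B]
    [Countable ι] [Nonempty ι] [Countable κ] [Nonempty κ] (μ : Measure A) (ν : Measure B)
    [IsProbabilityMeasure μ] [IsProbabilityMeasure ν] {n m : ℕ} (hn : 0 < n) (hm : 0 < m)
    {S : ι → (Fin n → A) → ℝ} {T : κ → (Fin m → B) → ℝ} (hS : ∀ i, Measurable (S i))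
    (hT : ∀ i, Measurable (T i)) {C C' : ℝ} (hSC : ∀ i x, |S i x| ≤ C) (hTC : ∀ i y, |T i y| ≤ C')
    {c d : ℝ} (hc0 : 0 ≤ c) (hd0 : 0 ≤ d)
    (hc : ∀ i x k u, |S i (Function.update x k u) - S i x| ≤ c / n)
    (hd : ∀ i y k u, |T i (Function.update y k u) - T i y| ≤ d / m) {ε r s : ℝ} (hε : 0 ≤ ε)
    (hr : ∫ x, supDev S x ∂(Measure.pi fun _ : Fin n => μ) ≤ r)
    (hs : ∫ y, supDev T y ∂(Measure.pi fun _ : Fin m => ν) ≤ s) :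
    ((Measure.pi fun _ : Fin n => μ).prod (Measure.pi fun _ : Fin m => ν)).real
      {p | ε + (s + r) ≤ supDev S p.1 + supDev T p.2} ≤
      Real.exp (-ε ^ 2 / ((2 / m) * d ^ 2 + (2 / n) * c ^ 2)) := by
  have hn' : (0 : ℝ) < n := by exact_mod_cast hn
  have hm' : (0 : ℝ) < m := by exact_mod_cast hm
  have hSm := measurable_supDev hS
  have hTm := measurable_supDev hT
  have hSi : Integrable (supDev S) (Measure.pi fun _ : Fin n => μ) :=
    .of_bound hSm.aestronglyMeasurable (C + C) (ae_of_all _ (abs_supDev_le hSC))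
  have hTi : Integrable (supDev T) (Measure.pi fun _ : Fin m => ν) :=
    .of_bound hTm.aestronglyMeasurable (C' + C') (ae_of_all _ (abs_supDev_le hTC))
  have hint : ∫ p, (supDev S p.1 + supDev T p.2)
      ∂((Measure.pi fun _ : Fin n => μ).prod (Measure.pi fun _ : Fin m => ν)) ≤ s + r := by
    rw [integral_add (hSi.comp_fst _) (hTi.comp_snd _), integral_fun_fst, integral_fun_snd]
    simp only [probReal_univ, one_smul]
    linarith
  have key := measure_ge_le_of_bounded_differences μ ν n m
    (F := fun p => supDev S p.1 + supDev T p.2)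
    ((hSm.comp measurable_fst).add (hTm.comp measurable_snd)) (C := (C + C) + (C' + C'))
    (fun p => (abs_add_le _ _).trans (add_le_add (abs_supDev_le hSC p.1) (abs_supDev_le hTC p.2)))
    (c := .mk (c / n + c / n) (by positivity)) (d := .mk (d / m + d / m) (by positivity))
    (fun x y k u => by
      rw [add_sub_add_right_eq_sub]
      exact abs_supDev_sub_le hSC fun i => hc i x k u)
    (fun x y k u => by
      rw [add_sub_add_left_eq_sub]
      exact abs_supDev_sub_le hTC fun i => hd i y k u) hε
  refine (measureReal_mono fun p hp => ?_).trans (key.trans_eq ?_)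
  · simp only [mem_ofPred_eq] at hp ⊢
    linarith
  · congr 1
    have : (n : ℝ) * (c / n + c / n) ^ 2 + m * (d / m + d / m) ^ 2 =
        2 * ((2 / m) * d ^ 2 + (2 / n) * c ^ 2) := by
      field_simp
      ring
    rw [NNReal.coe_mk, NNReal.coe_mk, this, ← mul_neg, mul_div_mul_left _ _ two_ne_zero]

end Assembly

open MeasureTheory in
/-- Reverse `(f,Γ)`-GAN concentration inequality. -/
theorem stmt19
    {X : Type*} [TopologicalSpace X] [MeasurableSpace X] [BorelSpace X]
    (f : ℝ → ℝ) (a : ℝ) (b : EReal) (α β : ℝ)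
    (ha0 : 0 ≤ a) (ha1 : a < 1) (hb1 : ((1 : ℝ) : EReal) < b)
    (hconv : ConvexOn ℝ (Dom a b) f) (hf1 : f 1 = 0)
    (hstrict : ∃ ε > 0, Set.Ioo (1 - ε) (1 + ε) ⊆ Dom a b ∧
      StrictConvexOn ℝ (Set.Ioo (1 - ε) (1 + ε)) f)
    (hz : zz f + β - α ∈ interior {z : ℝ | fStar f a b z < ⊤})
    (hαβ : α < β)
    (Γt Γ : Set (X → ℝ)) (hsub : Γt ⊆ Γ) (hΓtne : Γt.Nonempty)
    (hcont : ∀ h ∈ Γ, Continuous h) (hbd : ∀ h ∈ Γ, ∀ x, h x ∈ Set.Icc α β)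
    (hΓd : PtwiseDenseCount Γ) (hΓtd : PtwiseDenseCount Γt)
    {Z : Type*} [MeasurableSpace Z] (PZ : Measure Z) [IsProbabilityMeasure PZ]
    {Θ : Type*} [MetricSpace Θ] [TopologicalSpace.SeparableSpace Θ] [Nonempty Θ]
    [MeasurableSpace Θ] [BorelSpace Θ]
    (Φ : Θ → Z → X) (hΦm : ∀ θ, Measurable (Φ θ)) (hΦc : ∀ z, Continuous fun θ => Φ θ z)
    (Q : Measure X) [IsProbabilityMeasure Q]
    {Ω : Type*} [MeasurableSpace Ω] (ℙ : Measure Ω) [IsProbabilityMeasure ℙ]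
    (n m : ℕ) (hn : 0 < n) (hm : 0 < m)
    (Xs : Fin n → Ω → X) (Zs : Fin m → Ω → Z)
    (hXm : ∀ i, Measurable (Xs i)) (hZm : ∀ j, Measurable (Zs j))
    (hlaw : Measure.map (fun ω => (fun i => Xs i ω, fun j => Zs j ω)) ℙ =
      (Measure.pi fun _ : Fin n => Q).prod (Measure.pi fun _ : Fin m => PZ))
    (θstar : Ω → Θ) (hθm : Measurable θstar)
    (εopt : ℝ) (hεopt : 0 ≤ εopt)
    (hopt : ∀ᵐ ω ∂ℙ,
      Dfg f a b Γt (Measure.map (Φ (θstar ω)) (empMeas m fun j => Zs j ω))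
          (empMeas n fun i => Xs i ω) ≤
        (⨅ θ : Θ, Dfg f a b Γt (Measure.map (Φ θ) (empMeas m fun j => Zs j ω))
          (empMeas n fun i => Xs i ω)) + εopt)
    (K : ℝ) (hK : Kchoice f a b α β Γt Q n K)
    (ε : ℝ) (hε : 0 < ε) :
    (ℙ {ω | Dfg f a b Γ (Measure.map (Φ (θstar ω)) PZ) Q
          - (⨅ θ : Θ, Dfg f a b Γ (Measure.map (Φ θ) PZ) Q) ≥
        ε + (1 + rderiv (fStarR f a b) (zz f + β - α)) * approxErr Γ Γt
          + εopt
          + 4 * rad {g : Z → ℝ | ∃ h ∈ Γt, ∃ θ : Θ, g = fun z => h (Φ θ z)} PZ m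
          + 4 * K}).toReal ≤
      Real.exp (-(ε ^ 2) /
        ((2 / (m : ℝ)) * (β - α) ^ 2 + (2 / (n : ℝ)) * (Δq f a b α β n) ^ 2)) := by
  have hf : IsGenerator f a b (β - α) :=
    ⟨ha0, ⟨ha1, hb1⟩, hconv, hf1, sub_pos.2 hαβ, by rwa [← add_sub_assoc]⟩
  obtain ⟨ν, D⟩ := hf.exists_isShiftData
  obtain ⟨g, hg⟩ := hΓtd.exists_isSeqDenseIn hΓtne
  have hmΓ : ∀ h ∈ Γ, Measurable h := fun h hh => (hcont h hh).measurable
  have hgm : ∀ i, Measurable (g i) := fun i => hmΓ _ (hsub (hg.mem i))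
  have hgb : ∀ i x, g i x ∈ Icc α β := fun i => hbd _ (hsub (hg.mem i))
  have hG := hg.comp (fun h hh => hcont h (hsub hh)) hΦc
  set G : ℕ × ℕ → Z → ℝ := fun q z => g q.1 (Φ (TopologicalSpace.denseSeq Θ q.2) z)
  have hGm : ∀ q, Measurable (G q) := fun q => (hgm q.1).comp (hΦm _)
  have hGb : ∀ q z, G q z ∈ Icc α β := fun q z => hgb _ _
  have hGC : ∀ q z, |G q z| ≤ |α| + |β| := fun q z => abs_le_of_mem_Icc (hGb q z)
  have hPn := fun x : Fin n → X => isProbabilityMeasure_empMeas hn x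
  have hPm := fun z : Fin m → Z => isProbabilityMeasure_empMeas hm z
  set S : ℕ → (Fin n → X) → ℝ := fun i x =>
    shiftInf (fStarR f a b) ν (empMeas n x) (g i) - shiftInf (fStarR f a b) ν Q (g i) with hSdef
  set T : ℕ × ℕ → (Fin m → Z) → ℝ := fun q z =>
    (m : ℝ)⁻¹ * ∑ k, G q (z k) - ∫ y, G q y ∂PZ with hTdef
  have hSm : ∀ i, Measurable (S i) := fun i =>
    (D.measurable_shiftInf_empMeas (hgm i)).sub_const _
  have hTm : ∀ q, Measurable (T q) := fun q => measurable_avg_sub_integral (hGm q) PZ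
  have hSC : ∀ i x, |S i x| ≤ β - α := fun i x =>
    D.abs_shiftInf_sub_shiftInf_le (hgm i) (hgb i)
  have hTC : ∀ q z, |T q z| ≤ (|α| + |β|) + (|α| + |β|) := fun q z =>
    abs_avg_sub_integral_le (hGC q) PZ z
  have hSc : ∀ i x k u, |S i (Function.update x k u) - S i x| ≤ Δq f a b α β n / n :=
    fun i x k u => by
      rw [hSdef, sub_sub_sub_cancel_right]
      exact D.abs_shiftInf_empMeas_update_sub_le hn (hgm i) (hgb i) x k u
  have hTc : ∀ q z k u, |T q (Function.update z k u) - T q z| ≤ (β - α) / m :=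
    fun q z k u => by
      rw [hTdef, sub_sub_sub_cancel_right]
      exact abs_avg_update_sub_le (hGb q) z k u
  have hΔ : 0 ≤ Δq f a b α β n := by
    obtain ⟨x₀⟩ := Q.nonempty_of_neZero
    have := (abs_nonneg _).trans (hSc 0 (fun _ => x₀) ⟨0, hn⟩ x₀)
    rwa [le_div_iff₀ (by exact_mod_cast hn), zero_mul] at this
  have key := measure_supDev_add_supDev_ge_le Q PZ hn hm hSm hTm hSC hTC hΔ
    (sub_nonneg.2 hαβ.le) hSc hTc hε.le (hf.integral_supDev_shiftInf_le D hg hgm hgb Q hn hK)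
    (hG.integral_supDev_avg_le hGm hGb PZ hm)
  have hmeas : MeasurableSet {p : (Fin n → X) × (Fin m → Z) |
      ε + (4 * rad {g : Z → ℝ | ∃ h ∈ Γt, ∃ θ : Θ, g = fun z => h (Φ θ z)} PZ m + 4 * K) ≤
        supDev S p.1 + supDev T p.2} :=
    measurableSet_le measurable_const (((measurable_supDev hSm).comp measurable_fst).add
      ((measurable_supDev hTm).comp measurable_snd))
  have hpair : Measurable fun ω => (fun i => Xs i ω, fun j => Zs j ω) :=
    (measurable_pi_lambda _ hXm).prodMk (measurable_pi_lambda _ hZm)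
  rw [measureReal_def, ← hlaw, Measure.map_apply hpair hmeas] at key
  refine (ENNReal.toReal_mono (measure_ne_top _ _) (measure_mono_ae ?_)).trans key
  filter_upwards [hopt] with ω hω hmem
  have hprob : ∀ θ, IsProbabilityMeasure (Measure.map (Φ θ) PZ) := fun θ =>
    Measure.isProbabilityMeasure_map (hΦm θ).aemeasurable
  have hprob' : ∀ θ, IsProbabilityMeasure (Measure.map (Φ θ) (empMeas m fun j => Zs j ω)) :=
    fun θ => Measure.isProbabilityMeasure_map (hΦm θ).aemeasurable
  have hmap : ∀ h ∈ Γt, ∀ θ (P : Measure Z), ∫ x, h x ∂(Measure.map (Φ θ) P) =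
      ∫ z, h (Φ θ z) ∂P := fun h hh θ P =>
    integral_map (hΦm θ).aemeasurable (hmΓ h (hsub hh)).aestronglyMeasurable
  have havg : ∀ h ∈ Γt, ∀ θ, ∫ z, h (Φ θ z) ∂(empMeas m fun j => Zs j ω) =
      (m : ℝ)⁻¹ * ∑ k, h (Φ θ (Zs k ω)) := fun h hh θ =>
    integral_empMeas _ ((hmΓ h (hsub hh)).comp (hΦm θ))
  have hI : IsBoundedSeqCont α β fun ψ : Z → ℝ => ∫ y, ψ y ∂PZ := isBoundedSeqCont_integral PZ
  have hE : IsBoundedSeqCont α β fun ψ : Z → ℝ => (m : ℝ)⁻¹ * ∑ k, ψ (Zs k ω) := by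
    simpa using isBoundedSeqCont_avg (α := α) (β := β) (fun _ => 1) fun k => Zs k ω
  have hQ : IsBoundedSeqCont α β fun ψ => shiftInf (fStarR f a b) ν Q ψ := D.isBoundedSeqCont Q
  have hQ' := D.isBoundedSeqCont (empMeas n fun i => Xs i ω)
  have hdev := hf.Dfg_sub_iInf_le D hsub hΓtne hmΓ hbd (P := fun θ => Measure.map (Φ θ) PZ)
    (P' := fun θ => Measure.map (Φ θ) (empMeas m fun j => Zs j ω)) (Q := Q)
    (Q' := empMeas n fun i => Xs i ω)
    (A := ⨆ q, -T q fun j => Zs j ω) (A' := ⨆ q, T q fun j => Zs j ω)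
    (B := ⨆ i, S i fun i => Xs i ω) (B' := ⨆ i, -S i fun i => Xs i ω)
    (fun h hh θ => by
      rw [hmap h hh, hmap h hh, havg h hh]
      simp only [hTdef, neg_sub]
      exact hG.apply_le_ciSup hGm hGb (hI.sub hE)
        (fun q => by rw [abs_sub_comm]; exact hTC q _) ⟨h, hh, θ, rfl⟩)
    (fun h hh θ => by
      rw [hmap h hh, hmap h hh, havg h hh]
      exact hG.apply_le_ciSup hGm hGb (hE.sub hI) (fun q => hTC q _) ⟨h, hh, θ, rfl⟩)
    (fun h hh => by
      rw [hf.cgfR_eq D (hmΓ h (hsub hh)) (hbd h (hsub hh)),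
        hf.cgfR_eq D (hmΓ h (hsub hh)) (hbd h (hsub hh))]
      exact hg.apply_le_ciSup hgm hgb (hQ'.sub hQ) (fun i => hSC i _) hh)
    (fun h hh => by
      rw [hf.cgfR_eq D (hmΓ h (hsub hh)) (hbd h (hsub hh)),
        hf.cgfR_eq D (hmΓ h (hsub hh)) (hbd h (hsub hh))]
      simp only [hSdef, neg_sub]
      exact hg.apply_le_ciSup hgm hgb (hQ.sub hQ')
        (fun i => by rw [abs_sub_comm]; exact hSC i _) hh) hω
  have hge := ge_iff_le.1 (show _ ≥ _ from hmem)
  rw [add_sub_assoc] at hge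
  change _ ≤ supDev S (fun i => Xs i ω) + supDev T (fun j => Zs j ω)
  rw [supDev, supDev]
  linarith
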